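/- arXiv:0901.1174 — 9 statements merged into one kernel-verified Lean document; each statement's English description precedes it below -/
import Mathlib

section
/- Let R be a commutative noetherian ring and let 0 → Y → P → X → 0 be a short exact sequence of finitely generated R-modules in which P is projective. Then the nonfree locus of X equals the support of the finitely generated R-module Ext^1_R(X,Y), i.e., NF(X) = Supp(Ext^1_R(X,Y)). -/
open CategoryTheory

noncomputable section

variable (R : Type) [CommRing R]

/-- The nonfree locus of a module: primes where the localization is not free. -/
def nonfreeLocus (M : ModuleCat R) : Set (PrimeSpectrum R) :=
  {p | ¬ Module.Free (Localization.AtPrime p.asIdeal)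
      (LocalizedModule p.asIdeal.primeCompl M)}

/-- The nonfree locus of a class of modules. -/
def nonfreeLocusSet (𝒳 : Set (ModuleCat R)) : Set (PrimeSpectrum R) :=
  ⋃ X ∈ 𝒳, nonfreeLocus R X

/-- `N` is a direct summand of `M`. -/
def IsSummand (N M : ModuleCat R) : Prop :=
  ∃ (i : N ⟶ M) (p : M ⟶ N), i ≫ p = 𝟙 N

/-- `0 → L → M → N → 0` is a short exact sequence. -/
def SES (L M N : ModuleCat R) : Prop :=
  ∃ (f : L ⟶ M) (g : M ⟶ N),
    Function.Injective f ∧ Function.Surjective g ∧ Function.Exact f g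

/-- A resolving class of finitely generated modules. -/
structure IsResolving (𝒳 : Set (ModuleCat R)) : Prop where
  finite : ∀ M ∈ 𝒳, Module.Finite R M
  iso_closed : ∀ M N : ModuleCat R, Nonempty (M ≅ N) → M ∈ 𝒳 → N ∈ 𝒳
  proj_mem : ∀ M : ModuleCat R, Module.Finite R M → Module.Projective R M → M ∈ 𝒳
  summand_closed : ∀ M N : ModuleCat R, IsSummand R N M → M ∈ 𝒳 → N ∈ 𝒳
  ext_closed : ∀ L M N : ModuleCat R, SES R L M N → L ∈ 𝒳 → N ∈ 𝒳 → M ∈ 𝒳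
  ker_epi_closed : ∀ L M N : ModuleCat R, SES R L M N → M ∈ 𝒳 → N ∈ 𝒳 → L ∈ 𝒳

/-- The resolving closure of a class of modules. -/
def resClosure (𝒳 : Set (ModuleCat R)) : Set (ModuleCat R) :=
  ⋂₀ {𝒴 | IsResolving R 𝒴 ∧ 𝒳 ⊆ 𝒴}

/-- Finite direct sum of a family of modules. -/
def finDirectSum {n : ℕ} (f : Fin n → ModuleCat R) : ModuleCat R :=
  ModuleCat.of R (∀ i, f i)

/-- The class `res^n X`. -/
def resStep (X : ModuleCat R) : ℕ → Set (ModuleCat R)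
  | 0 => {M | ∃ (n : ℕ) (f : Fin n → ModuleCat R),
      (∀ i, f i = X ∨ f i = ModuleCat.of R R) ∧ IsSummand R M (finDirectSum R f)}
  | (n+1) => {M | ∃ (t : ℕ) (f : Fin t → ModuleCat R),
      (∀ i, (∃ A B, A ∈ resStep X n ∧ B ∈ resStep X n ∧ SES R A (f i) B) ∨
            (∃ A B, A ∈ resStep X n ∧ B ∈ resStep X n ∧ SES R (f i) A B)) ∧
      IsSummand R M (finDirectSum R f)}

/-- `step(X,Y)` : the least `n` with `Y ∈ res^n X`. -/
def step (X Y : ModuleCat R) : ℕ∞ :=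
  sInf {n : ℕ∞ | ∃ m : ℕ, n = (m : ℕ∞) ∧ Y ∈ resStep R X m}

/-- A module is indecomposable. -/
def Indec (M : ModuleCat R) : Prop :=
  Nontrivial M ∧ ∀ (A B : ModuleCat R), Nontrivial A → Nontrivial B →
    IsEmpty (M ≅ ModuleCat.of R (A × B))

/-- `Ext¹`. -/
def ext1 (X Y : ModuleCat R) : ModuleCat R :=
  ((Ext R (ModuleCat R) 1).obj (Opposite.op X)).obj Y

/-- Dimension of a subset of `Spec R` : `sup { dim R/p }`. -/
def dimSet (Z : Set (PrimeSpectrum R)) : WithBot ℕ∞ :=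
  ⨆ p ∈ Z, ringKrullDim (R ⧸ (p : PrimeSpectrum R).asIdeal)

/-- The height of `p` with respect to a subset `Z` of `Spec R`. -/
def heightWithin (Z : Set (PrimeSpectrum R)) (p : PrimeSpectrum R) : ℕ∞ :=
  ⨆ q ∈ Z, ⨆ (h : q ≤ p), Order.height (α := Set.Icc q p) ⟨p, ⟨h, le_rfl⟩⟩

/-- Depth of a module over a local ring : the supremum of lengths of regular
sequences contained in the maximal ideal. -/
def moduleDepth [IsLocalRing R] (M : Type) [AddCommGroup M] [Module R M] : ℕ∞ :=
  ⨆ (rs : List R) (_ : (∀ r ∈ rs, r ∈ IsLocalRing.maximalIdeal R) ∧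
      RingTheory.Sequence.IsRegular M rs), (rs.length : ℕ∞)

/-- The singular locus: primes `p` such that `R_p` is not regular, i.e. the maximal
ideal of `R_p` cannot be generated by `dim R_p` elements. -/
def singularLocus : Set (PrimeSpectrum R) :=
  {p | ¬ ∃ (s : Finset (Localization.AtPrime p.asIdeal)),
      Ideal.span (s : Set (Localization.AtPrime p.asIdeal)) =
        IsLocalRing.maximalIdeal (Localization.AtPrime p.asIdeal) ∧
      (s.card : WithBot ℕ∞) = ringKrullDim (Localization.AtPrime p.asIdeal)}

end

/-- A finitely presented quotient `g : P → X` of a projective module is free at the prime `p` if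
and only if multiplication by some `s ∉ p` on `X` factors through `g`. -/
lemma Module.free_localizedModule_iff_exists_comp_eq_smul {R P X : Type*} [CommRing R]
    [AddCommGroup P] [Module R P] [AddCommGroup X] [Module R X] [Module.FinitePresentation R X]
    [Module.Projective R P] (g : P →ₗ[R] X) (hg : Function.Surjective g)
    (p : Ideal R) [p.IsPrime] :
    Module.Free (Localization.AtPrime p) (LocalizedModule p.primeCompl X) ↔
      ∃ s ∉ p, ∃ k : X →ₗ[R] P, g ∘ₗ k = s • LinearMap.id := by
  constructor
  · intro _
    obtain ⟨σ, hσ⟩ := Module.projective_lifting_property (LocalizedModule.map p.primeCompl g)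
      LinearMap.id (LocalizedModule.map_surjective _ _ hg)
    obtain ⟨k, s, hk⟩ := Module.FinitePresentation.exists_lift_of_isLocalizedModule p.primeCompl
      (LocalizedModule.mkLinearMap p.primeCompl P)
      (σ.restrictScalars R ∘ₗ LocalizedModule.mkLinearMap p.primeCompl X)
    obtain ⟨t, ht⟩ := Module.Finite.exists_smul_of_comp_eq_of_isLocalizedModule p.primeCompl
      (LocalizedModule.mkLinearMap p.primeCompl X) (g ∘ₗ k) (s • LinearMap.id) (by
        ext x
        have h₁ := congr(LocalizedModule.map p.primeCompl g ($hk x))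
        have h₂ := congr($hσ (LocalizedModule.mkLinearMap p.primeCompl X x))
        simp only [LinearMap.comp_apply, LinearMap.smul_apply, LinearMap.restrictScalars_apply,
          LinearMap.map_smul_of_tower, LinearMap.id_apply] at h₁ h₂ ⊢
        rw [h₂] at h₁
        rw [← h₁]
        simp [LocalizedModule.map_mk])
    refine ⟨t * s, (t * s).2, (t : R) • k, ?_⟩
    rw [LinearMap.comp_smul, mul_smul]
    exact ht
  · rintro ⟨s, hs, k, hk⟩
    have hu : IsUnit (algebraMap R (Localization.AtPrime p) s) :=
      IsLocalization.map_units (M := p.primeCompl) _ ⟨s, hs⟩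
    have : Module.Projective (Localization.AtPrime p) (LocalizedModule p.primeCompl X) := by
      refine Module.Projective.of_split
        ((↑hu.unit⁻¹ : Localization.AtPrime p) • LocalizedModule.map p.primeCompl k)
        (LocalizedModule.map p.primeCompl g) ?_
      ext x
      induction x using LocalizedModule.induction_on with
      | h m t =>
        have hm : g (k m) = s • m := congr($hk m)
        have h : LocalizedModule.mk (s • m) t = (algebraMap R (Localization.AtPrime p) s) •
            LocalizedModule.mk m t := by
          rw [algebraMap_smul, LocalizedModule.smul'_mk]
        rw [LinearMap.comp_apply, LinearMap.smul_apply, map_smul, LocalizedModule.map_mk,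
          LocalizedModule.map_mk, hm, h, smul_smul, IsUnit.val_inv_mul, one_smul,
          LinearMap.id_apply]
    exact Module.free_of_flat_of_isLocalRing

namespace CategoryTheory

/-- The support of the homology of a complex of modules is detected on cycles. -/
lemma ShortComplex.notMem_support_homology_iff {R : Type*} [CommRing R]
    (S : ShortComplex (ModuleCat R)) (p : PrimeSpectrum R) :
    p ∉ Module.support R S.homology ↔
      ∀ c : S.X₂, S.g c = 0 → ∃ s ∉ p.asIdeal, ∃ b : S.X₁, S.f b = s • c := by
  rw [LinearEquiv.support_eq S.moduleCatHomologyIso.toLinearEquiv, Module.notMem_support_iff']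
  have key (s : R) (c : LinearMap.ker S.g.hom) :
      s • Submodule.Quotient.mk (p := LinearMap.range S.moduleCatToCycles) c = 0 ↔
        ∃ b : S.X₁, S.f b = s • c.1 := by
    rw [← Submodule.Quotient.mk_smul, Submodule.Quotient.mk_eq_zero, LinearMap.mem_range]
    simp only [Subtype.ext_iff]
    rfl
  constructor
  · intro h c hc
    obtain ⟨s, hs, h⟩ := h (Submodule.Quotient.mk ⟨c, hc⟩)
    exact ⟨s, hs, (key s ⟨c, hc⟩).1 h⟩
  · intro h m
    obtain ⟨c, rfl⟩ := Submodule.Quotient.mk_surjective _ m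
    obtain ⟨s, hs, h⟩ := h c.1 c.2
    exact ⟨s, hs, (key s c).2 h⟩

namespace ProjectiveResolution

variable {R C : Type*} [Ring R] [Category* C] [Abelian C] [Linear R C]

/-- If multiplication by `s` on `X` factors through a projective object, then `s` times a
`1`-cocycle of a projective resolution of `X` is a coboundary. -/
lemma exists_d_comp_eq_smul_of_comp_eq_smul {X Y P : C} [Projective P]
    (Q : ProjectiveResolution X) {g : P ⟶ X} {k : X ⟶ P} {s : R} (hk : k ≫ g = s • 𝟙 X)
    (c : Q.complex.X 1 ⟶ Y) (hc : Q.complex.d 2 1 ≫ c = 0) :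
    ∃ b : Q.complex.X 0 ⟶ Y, Q.complex.d 1 0 ≫ b = s • c := by
  let ε : Q.complex.X 0 ⟶ X := Q.π.f 0
  have : Epi ε := inferInstanceAs (Epi (Q.π.f 0))
  have hd : Q.complex.d 1 0 ≫ ε = 0 := Q.complex_d_comp_π_f_zero
  let ψ : P ⟶ Q.complex.X 0 := Projective.factorThru g ε
  have hψ : ψ ≫ ε = g := Projective.factorThru_comp _ _
  let τ : Q.complex.X 0 ⟶ Q.complex.X 0 := s • 𝟙 _ - ε ≫ k ≫ ψ
  have hτ : τ ≫ ε = 0 := by simp [τ, hψ, hk]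
  let θ : Q.complex.X 0 ⟶ Q.complex.X 1 := Q.exact₀.liftFromProjective τ hτ
  have hθ : θ ≫ Q.complex.d 1 0 = τ := Q.exact₀.liftFromProjective_comp τ hτ
  let ρ : Q.complex.X 1 ⟶ Q.complex.X 1 := Q.complex.d 1 0 ≫ θ - s • 𝟙 _
  have hρ : ρ ≫ Q.complex.d 1 0 = 0 := by
    simp [ρ, hθ, τ, reassoc_of% hd]
  have hρc : ρ ≫ c = 0 := by
    rw [← (Q.exact_succ 0).liftFromProjective_comp ρ hρ, Category.assoc]
    simp [hc]
  refine ⟨θ ≫ c, ?_⟩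
  simpa [ρ, sub_eq_zero] using hρc

/-- Given an extension `0 → Y → P → X → 0`, there is a `1`-cocycle of a projective resolution of `X`
such that if `s` times it is a coboundary, then multiplication by `s` on `X` factors
through `P`. -/
lemma exists_cocycle_forall_comp_eq_smul {S : ShortComplex C} (hS : S.ShortExact)
    (Q : ProjectiveResolution S.X₃) :
    ∃ c : Q.complex.X 1 ⟶ S.X₁, Q.complex.d 2 1 ≫ c = 0 ∧
      ∀ (s : R) (b : Q.complex.X 0 ⟶ S.X₁), Q.complex.d 1 0 ≫ b = s • c →
        ∃ k : S.X₃ ⟶ S.X₂, k ≫ S.g = s • 𝟙 S.X₃ := by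
  have := hS.mono_f
  have := hS.epi_g
  let ε : Q.complex.X 0 ⟶ S.X₃ := Q.π.f 0
  have : Epi ε := inferInstanceAs (Epi (Q.π.f 0))
  have hd : Q.complex.d 1 0 ≫ ε = 0 := Q.complex_d_comp_π_f_zero
  let φ : Q.complex.X 0 ⟶ S.X₂ := Projective.factorThru ε S.g
  have hφ : φ ≫ S.g = ε := Projective.factorThru_comp _ _
  have hdφ : (Q.complex.d 1 0 ≫ φ) ≫ S.g = 0 := by rw [Category.assoc, hφ, hd]
  let c : Q.complex.X 1 ⟶ S.X₁ := hS.exact.liftFromProjective _ hdφ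
  have hc : c ≫ S.f = Q.complex.d 1 0 ≫ φ := hS.exact.liftFromProjective_comp _ hdφ
  refine ⟨c, by simp [← cancel_mono S.f, hc], fun s b hb ↦ ?_⟩
  have hk : Q.complex.d 1 0 ≫ (s • φ - b ≫ S.f) = 0 := by
    simp [reassoc_of% hb, hc]
  obtain ⟨(k : S.X₃ ⟶ S.X₂), hk⟩ := Limits.CokernelCofork.IsColimit.desc' Q.isColimitCokernelCofork _ hk
  replace hk : ε ≫ k = s • φ - b ≫ S.f := hk
  exact ⟨k, by simp [← cancel_epi ε, reassoc_of% hk, hφ]⟩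

end ProjectiveResolution

end CategoryTheory

/-- A prime `p` is outside the support of `Ext¹(X, Y)` if and only if multiplication by some
`s ∉ p` on `X` factors through the projective module in the middle
of an extension `0 → Y → P → X → 0`. -/
lemma notMem_support_ext1_iff {R : Type} [CommRing R] {S : ShortComplex (ModuleCat R)}
    (hS : S.ShortExact) [Projective S.X₂] (p : PrimeSpectrum R) :
    p ∉ Module.support R (ext1 R S.X₃ S.X₁) ↔
      ∃ s ∉ p.asIdeal, ∃ k : S.X₃ ⟶ S.X₂, k ≫ S.g = s • 𝟙 S.X₃ := by
  let Q := ProjectiveResolution.of S.X₃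
  have e : ext1 R S.X₃ S.X₁ ≅ ((Q.complex.linearYonedaObj R S.X₁).sc' 0 1 2).homology :=
    Q.isoExt 1 S.X₁ ≪≫ ShortComplex.homologyMapIso
      ((Q.complex.linearYonedaObj R S.X₁).isoSc' 0 1 2 (by simp) (by simp))
  rw [LinearEquiv.support_eq e.toLinearEquiv, ShortComplex.notMem_support_homology_iff]
  constructor
  · intro h
    obtain ⟨c, hc, H⟩ := ProjectiveResolution.exists_cocycle_forall_comp_eq_smul (R := R) hS Q
    obtain ⟨s, hs, b, hb⟩ := h c hc
    exact ⟨s, hs, H s b hb⟩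
  · rintro ⟨s, hs, k, hk⟩ c hc
    obtain ⟨b, hb⟩ := Q.exists_d_comp_eq_smul_of_comp_eq_smul hk c hc
    exact ⟨s, hs, b, hb⟩

/-- If `0 → Y → P → X → 0` is a short exact sequence of finitely
generated modules over a commutative noetherian ring with `P` projective, then
`NF(X) = Supp (Ext¹_R(X, Y))`. -/
theorem stmt0 (R : Type) [CommRing R] [IsNoetherianRing R]
    (X Y P : ModuleCat R) (hX : Module.Finite R X) (hY : Module.Finite R Y)
    (hP : Module.Finite R P) (hPproj : Module.Projective R P)
    (f : Y ⟶ P) (g : P ⟶ X)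
    (hf : Function.Injective f) (hg : Function.Surjective g)
    (hfg : Function.Exact f g) :
    nonfreeLocus R X = Module.support R ↥(ext1 R X Y) := by
  have : Module.FinitePresentation R X := Module.finitePresentation_of_finite R X
  let S : ShortComplex (ModuleCat R) :=
    ShortComplex.mk f g (ModuleCat.hom_ext hfg.linearMap_comp_eq_zero)
  have hS : S.ShortExact := ModuleCat.shortComplex_shortExact S hfg hf hg
  have : Projective S.X₂ := (IsProjective.iff_projective P).1 hPproj
  ext p
  refine not_iff_comm.1 ((notMem_support_ext1_iff hS p).trans ?_)
  refine Iff.trans ?_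
    (Module.free_localizedModule_iff_exists_comp_eq_smul g.hom hg p.asIdeal).symm
  refine exists_congr fun s ↦ and_congr_right fun _ ↦
    ⟨fun ⟨k, hk⟩ ↦ ⟨k.hom, congr(ModuleCat.Hom.hom $hk)⟩,
      fun ⟨k, hk⟩ ↦ ⟨ModuleCat.ofHom k, ModuleCat.hom_ext hk⟩⟩
end

section
/- Let R be a commutative noetherian ring, 𝒳 a class of finitely generated R-modules, and S a multiplicatively closed subset of R. Then for every finitely generated R-module M belonging to the resolving closure res_R 𝒳, the localized module M_S belongs to the resolving closure res_{R_S} 𝒳_S, where 𝒳_S denotes the class of R_S-modules isomorphic to X_S for some X ∈ 𝒳. -/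
open CategoryTheory

/-- Localization sends direct summands to direct summands. -/
theorem IsSummand.localizedModule {R : Type} [CommRing R] {N M : ModuleCat R}
    (h : IsSummand R N M) (S : Submonoid R) :
    IsSummand (Localization S) (ModuleCat.of (Localization S) (LocalizedModule S N))
      (ModuleCat.of (Localization S) (LocalizedModule S M)) := by
  obtain ⟨i, p, hip⟩ := h
  refine ⟨ModuleCat.ofHom (LocalizedModule.map S i.hom),
    ModuleCat.ofHom (LocalizedModule.map S p.hom), ?_⟩
  ext x
  induction x using LocalizedModule.induction_on with
  | h m s =>
    have hm : p.hom (i.hom m) = m := by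
      simpa using congrArg (fun f : N ⟶ N => f.hom m) hip
    simp [LocalizedModule.map_mk, hm]

/-- Localization sends short exact sequences to short exact sequences. -/
theorem SES.localizedModule {R : Type} [CommRing R] {L M N : ModuleCat R}
    (h : SES R L M N) (S : Submonoid R) :
    SES (Localization S) (ModuleCat.of (Localization S) (LocalizedModule S L))
      (ModuleCat.of (Localization S) (LocalizedModule S M))
      (ModuleCat.of (Localization S) (LocalizedModule S N)) := by
  obtain ⟨f, g, hf, hg, hfg⟩ := h
  exact ⟨ModuleCat.ofHom (LocalizedModule.map S f.hom),
    ModuleCat.ofHom (LocalizedModule.map S g.hom),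
    LocalizedModule.map_injective S f.hom hf, LocalizedModule.map_surjective S g.hom hg,
    LocalizedModule.map_exact S f.hom g.hom hfg⟩

/-- Over a noetherian ring, the finitely generated modules whose localization lies in a given
resolving class form a resolving class. -/
theorem IsResolving.comap_localizedModule {R : Type} [CommRing R] [IsNoetherianRing R]
    (S : Submonoid R) {𝒴 : Set (ModuleCat (Localization S))}
    (h𝒴 : IsResolving (Localization S) 𝒴) :
    IsResolving R {M : ModuleCat R | Module.Finite R M ∧
      ModuleCat.of (Localization S) (LocalizedModule S M) ∈ 𝒴} := by
  have summand : ∀ M N : ModuleCat R, IsSummand R N M →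
      (Module.Finite R M ∧ ModuleCat.of (Localization S) (LocalizedModule S M) ∈ 𝒴) →
      Module.Finite R N ∧ ModuleCat.of (Localization S) (LocalizedModule S N) ∈ 𝒴 := by
    rintro M N h ⟨_, hM⟩
    refine ⟨?_, h𝒴.summand_closed _ _ (h.localizedModule S) hM⟩
    obtain ⟨i, p, hip⟩ := h
    exact Module.Finite.of_surjective p.hom fun x =>
      ⟨i.hom x, by simpa using congrArg (fun f : N ⟶ N => f.hom x) hip⟩
  refine ⟨fun M hM => hM.1, ?_, ?_, summand, ?_, ?_⟩
  · rintro M N ⟨e⟩ hM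
    exact summand M N ⟨e.inv, e.hom, e.inv_hom_id⟩ hM
  · intro M _ _
    exact ⟨inferInstance, h𝒴.proj_mem _ (inferInstanceAs
      (Module.Finite (Localization S) (LocalizedModule S M))) (inferInstanceAs
      (Module.Projective (Localization S) (LocalizedModule S M)))⟩
  · rintro L M N h ⟨_, hL⟩ ⟨_, hN⟩
    refine ⟨?_, h𝒴.ext_closed _ _ _ (h.localizedModule S) hL hN⟩
    obtain ⟨f, g, -, -, hfg⟩ := h
    have := isNoetherian_of_range_eq_ker f.hom g.hom (LinearMap.exact_iff.mp hfg).symm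
    infer_instance
  · rintro L M N h ⟨_, hM⟩ ⟨_, hN⟩
    refine ⟨?_, h𝒴.ker_epi_closed _ _ _ (h.localizedModule S) hM hN⟩
    obtain ⟨f, -, hf, -⟩ := h
    exact Module.Finite.of_injective f.hom hf

/-- Localization of the resolving closure: if `M` is a finitely
generated module in `res_R 𝒳`, then `M_S ∈ res_{R_S} 𝒳_S`. -/
theorem stmt3 (R : Type) [CommRing R] [IsNoetherianRing R]
    (𝒳 : Set (ModuleCat R)) (h𝒳 : ∀ X ∈ 𝒳, Module.Finite R X)
    (S : Submonoid R) (M : ModuleCat R) (hM : Module.Finite R M)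
    (hMres : M ∈ resClosure R 𝒳) :
    ModuleCat.of (Localization S) (LocalizedModule S M) ∈
      resClosure (Localization S)
        {N : ModuleCat (Localization S) | ∃ X ∈ 𝒳,
          Nonempty (N ≅ ModuleCat.of (Localization S) (LocalizedModule S X))} := by
  rintro 𝒴 ⟨h𝒴, hsub⟩
  exact (hMres _ ⟨h𝒴.comap_localizedModule S,
    fun X hX => ⟨h𝒳 X hX, hsub ⟨X, hX, ⟨Iso.refl _⟩⟩⟩⟩).2
end

section
/- Let R be a commutative noetherian ring and 𝒳 a class of finitely generated R-modules. Then NF(res 𝒳) = NF(𝒳): the nonfree locus of the resolving closure of 𝒳 coincides with the nonfree locus of 𝒳. -/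
open CategoryTheory

/-- A short exact sequence localizes to a short exact sequence over the localized ring. -/
theorem localizedModule_map_shortExact {R L M N : Type*} [CommRing R] (S : Submonoid R)
    [AddCommGroup L] [Module R L] [AddCommGroup M] [Module R M] [AddCommGroup N] [Module R N]
    {f : L →ₗ[R] M} {g : M →ₗ[R] N} (hf : Function.Injective f) (hg : Function.Surjective g)
    (hfg : Function.Exact f g) :
    Function.Injective (LocalizedModule.map S f) ∧ Function.Surjective (LocalizedModule.map S g) ∧
      Function.Exact (LocalizedModule.map S f) (LocalizedModule.map S g) :=
  ⟨LocalizedModule.map_injective S f hf, LocalizedModule.map_surjective S g hg,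
    LocalizedModule.map_exact S f g hfg⟩

/-- A retract of a module localizes to a retract. -/
theorem localizedModule_map_comp_eq_id {R M N : Type*} [CommRing R] (S : Submonoid R)
    [AddCommGroup M] [Module R M] [AddCommGroup N] [Module R N]
    {i : N →ₗ[R] M} {r : M →ₗ[R] N} (h : r ∘ₗ i = LinearMap.id) :
    LocalizedModule.map S r ∘ₗ LocalizedModule.map S i = LinearMap.id := by
  ext x
  induction x using LocalizedModule.induction_on with
  | h m s => simp [LocalizedModule.map_mk, show r (i m) = m from LinearMap.congr_fun h m]

/-- The finitely generated modules that are free at a given prime form a resolving class. -/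
theorem isResolving_finite_freeAt (R : Type) [CommRing R] [IsNoetherianRing R]
    (p : PrimeSpectrum R) :
    IsResolving R {M | Module.Finite R M ∧ p ∉ nonfreeLocus R M} := by
  have free_of_projective (M : ModuleCat R) [Module.Finite R M]
      (_ : Module.Projective (Localization.AtPrime p.asIdeal)
        (LocalizedModule p.asIdeal.primeCompl M)) : p ∉ nonfreeLocus R M :=
    have := Module.Flat.of_projective (R := Localization.AtPrime p.asIdeal)
      (M := LocalizedModule p.asIdeal.primeCompl M)
    not_not_intro Module.free_of_flat_of_isLocalRing
  have projective_of_notMem {M : ModuleCat R} (hM : p ∉ nonfreeLocus R M) :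
      Module.Projective (Localization.AtPrime p.asIdeal)
        (LocalizedModule p.asIdeal.primeCompl M) :=
    have : Module.Free (Localization.AtPrime p.asIdeal)
      (LocalizedModule p.asIdeal.primeCompl M) := not_not.mp hM
    Module.Projective.of_free
  have summand_closed (M N : ModuleCat R) (h : IsSummand R N M)
      (hM : Module.Finite R M ∧ p ∉ nonfreeLocus R M) :
      Module.Finite R N ∧ p ∉ nonfreeLocus R N := by
    obtain ⟨i, r, hir⟩ := h
    obtain ⟨hfin, hfree⟩ := hM
    have hir' : r.hom ∘ₗ i.hom = LinearMap.id := congrArg ModuleCat.Hom.hom hir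
    have hN : Module.Finite R N := .of_surjective r.hom fun x =>
      ⟨i.hom x, LinearMap.congr_fun hir' x⟩
    have := projective_of_notMem hfree
    exact ⟨hN, free_of_projective N <| .of_split _ _ <|
      localizedModule_map_comp_eq_id p.asIdeal.primeCompl hir'⟩
  have split {L M N : ModuleCat R} (h : SES R L M N) (hN : p ∉ nonfreeLocus R N) :
      Nonempty (LocalizedModule p.asIdeal.primeCompl M ≃ₗ[Localization.AtPrime p.asIdeal]
        LocalizedModule p.asIdeal.primeCompl L × LocalizedModule p.asIdeal.primeCompl N) := by
    obtain ⟨f, g, hf, hg, hfg⟩ := h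
    obtain ⟨hf', hg', hfg'⟩ := localizedModule_map_shortExact p.asIdeal.primeCompl
      (f := f.hom) (g := g.hom) hf hg hfg
    have := projective_of_notMem hN
    obtain ⟨l, hl⟩ := Module.projective_lifting_property _ LinearMap.id hg'
    exact ⟨(hfg'.splitSurjectiveEquiv hf' ⟨l, hl⟩).1⟩
  refine ⟨fun M hM => hM.1, ?_, ?_, summand_closed, ?_, ?_⟩
  · rintro M N ⟨e⟩ hM
    exact summand_closed M N ⟨e.inv, e.hom, e.inv_hom_id⟩ hM
  · intro M hfin hproj
    have : Module.Projective (Localization.AtPrime p.asIdeal)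
        (LocalizedModule p.asIdeal.primeCompl M) :=
      Module.projective_of_isLocalizedModule p.asIdeal.primeCompl
        (LocalizedModule.mkLinearMap p.asIdeal.primeCompl M)
    exact ⟨hfin, free_of_projective M this⟩
  · rintro L M N h ⟨hLfin, hL⟩ ⟨hNfin, hN⟩
    obtain ⟨e⟩ := split h hN
    obtain ⟨f, g, -, hg, hfg⟩ := h
    have hM : Module.Finite R M := Module.Finite.of_exact (f := f.hom) (g := g.hom) hfg hg
    have := projective_of_notMem hL
    have := projective_of_notMem hN
    exact ⟨hM, free_of_projective M <| .of_equiv e.symm⟩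
  · rintro L M N h ⟨hMfin, hM⟩ ⟨-, hN⟩
    obtain ⟨e⟩ := split h hN
    obtain ⟨f, g, hf, -, -⟩ := h
    have hL : Module.Finite R L := .of_injective f.hom hf
    have := projective_of_notMem hM
    have := Module.Projective.of_equiv e
    exact ⟨hL, free_of_projective L <| .of_split
      (LinearMap.inl _ _ (LocalizedModule p.asIdeal.primeCompl N)) (LinearMap.fst _ _ _) <|
      LinearMap.fst_comp_inl ..⟩

/-- `NF(res 𝒳) = NF(𝒳)`. -/
theorem stmt4 (R : Type) [CommRing R] [IsNoetherianRing R]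
    (𝒳 : Set (ModuleCat R)) (h𝒳 : ∀ X ∈ 𝒳, Module.Finite R X) :
    nonfreeLocusSet R (resClosure R 𝒳) = nonfreeLocusSet R 𝒳 := by
  refine Set.Subset.antisymm (fun p hp => ?_) <|
    Set.biUnion_subset_biUnion_left <| Set.subset_sInter fun _ h𝒴 => h𝒴.2
  by_contra hp'
  simp only [nonfreeLocusSet, Set.mem_iUnion, not_exists] at hp hp'
  obtain ⟨M, hM, hpM⟩ := hp
  exact (hM _ ⟨isResolving_finite_freeAt R p, fun X hX => ⟨h𝒳 X hX, hp' X hX⟩⟩).2 hpM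
end

section
/- Let R be a commutative noetherian ring and 𝒳 a class of finitely generated R-modules. Then NF(𝒳) equals the union, over all pairs (Y, Z) of indecomposable finitely generated R-modules belonging to the resolving closure res 𝒳, of Supp(Ext^1_R(Y,Z)). -/
open CategoryTheory

section LinearAlgebra

variable {R : Type*} [CommRing R]

lemma exists_comp_eq_of_surjective {A B C : Type*} [AddCommGroup A] [Module R A]
    [AddCommGroup B] [Module R B] [AddCommGroup C] [Module R C]
    (q : A →ₗ[R] B) (hq : Function.Surjective q) (x : A →ₗ[R] C)
    (h : ∀ a, q a = 0 → x a = 0) : ∃ f : B →ₗ[R] C, ∀ a, f (q a) = x a := by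
  refine ⟨(LinearMap.ker q).liftQ x h ∘ₗ (q.quotKerEquivOfSurjective hq).symm.toLinearMap, ?_⟩
  intro a
  have : (q.quotKerEquivOfSurjective hq).symm (q a) = Submodule.Quotient.mk a := by
    rw [LinearEquiv.symm_apply_eq]
    rfl
  exact congrArg ((LinearMap.ker q).liftQ x h) this

/-- Every linear map from the kernel of `π` to `Z` extends to the source of `π` after
multiplication by an element outside `p`. For `π` a surjection from a projective module onto `Y`,
this says that `Ext¹(Y, Z)` vanishes locally at `p`. -/
def LocallyExtends (p : PrimeSpectrum R) {E Y : Type*} [AddCommGroup E] [Module R E]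
    [AddCommGroup Y] [Module R Y] (π : E →ₗ[R] Y) (Z : Type*) [AddCommGroup Z] [Module R Z] :
    Prop :=
  ∀ f : LinearMap.ker π →ₗ[R] Z, ∃ s ∉ p.asIdeal, ∃ g : E →ₗ[R] Z,
    ∀ x : LinearMap.ker π, g x = s • f x

variable {p : PrimeSpectrum R} {E F Y Z : Type*} [AddCommGroup E] [Module R E]
  [AddCommGroup F] [Module R F] [AddCommGroup Y] [Module R Y] [AddCommGroup Z] [Module R Z]

lemma LocallyExtends.of_projective [Module.Projective R F] {π : F →ₗ[R] Y} {σ : E →ₗ[R] Y}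
    (hπ : Function.Surjective π) (hσ : Function.Surjective σ) (h : LocallyExtends p π Z) :
    LocallyExtends p σ Z := by
  intro f
  obtain ⟨φ, hφ⟩ := Module.projective_lifting_property σ π hσ
  have hφ' (x : F) : σ (φ x) = π x := LinearMap.congr_fun hφ x
  obtain ⟨s, hs, u, hu⟩ := h (f ∘ₗ φ.restrict (p := LinearMap.ker π) (q := LinearMap.ker σ)
    (fun x hx ↦ by simpa [hφ'] using hx))
  obtain ⟨g, hg⟩ := exists_comp_eq_of_surjective
    ((LinearMap.ker σ).subtype.coprod φ)
    (by
      intro e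
      obtain ⟨x, hx⟩ := hπ (σ e)
      exact ⟨(⟨e - φ x, by simp [hφ', hx]⟩, x), by simp⟩)
    ((s • f).coprod u)
    (by
      rintro ⟨k, x⟩ hkx
      have hk : (k : E) = -φ x := eq_neg_of_add_eq_zero_left (by simpa using hkx)
      have hx : π x = 0 := by
        have : σ (-φ x) = 0 := hk ▸ k.2
        simpa [hφ'] using this
      have hk' : k = -φ.restrict (p := LinearMap.ker π) (q := LinearMap.ker σ)
          (fun x hx ↦ by simpa [hφ'] using hx) ⟨x, hx⟩ := Subtype.ext (by simpa using hk)
      have := hu ⟨x, hx⟩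
      simp only [LinearMap.comp_apply] at this
      simp [hk', this])
  refine ⟨s, hs, g, fun x ↦ ?_⟩
  simpa using hg (x, 0)

lemma LocallyExtends.of_smul_section {π : F →ₗ[R] Y} {s : R} (hs : s ∉ p.asIdeal)
    {h : Y →ₗ[R] F} (hh : ∀ y, π (h y) = s • y) : LocallyExtends p π Z := by
  intro f
  refine ⟨s, hs, f ∘ₗ (s • LinearMap.id - h ∘ₗ π).codRestrict (LinearMap.ker π)
    (fun x ↦ by simp [hh]), fun x ↦ ?_⟩
  rw [LinearMap.comp_apply, ← map_smul]
  congr 1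
  ext
  simp [LinearMap.mem_ker.1 x.2]

lemma LocallyExtends.exists_smul_section {π : F →ₗ[R] Y} (hπ : Function.Surjective π)
    (h : LocallyExtends p π (LinearMap.ker π)) :
    ∃ s ∉ p.asIdeal, ∃ h : Y →ₗ[R] F, ∀ y, π (h y) = s • y := by
  obtain ⟨s, hs, g, hg⟩ := h LinearMap.id
  obtain ⟨h, hh⟩ := exists_comp_eq_of_surjective π hπ
    (s • LinearMap.id - (LinearMap.ker π).subtype ∘ₗ g) (fun x hx ↦ by
      have := congrArg Subtype.val (hg ⟨x, hx⟩)
      simp only [LinearMap.id_apply, Submodule.coe_smul] at this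
      simp [this])
  refine ⟨s, hs, h, fun y ↦ ?_⟩
  obtain ⟨x, rfl⟩ := hπ y
  simp [hh]

lemma LocallyExtends.prod_right {π : E →ₗ[R] Y} {Z₁ Z₂ : Type*} [AddCommGroup Z₁] [Module R Z₁]
    [AddCommGroup Z₂] [Module R Z₂] (e : Z ≃ₗ[R] Z₁ × Z₂)
    (h₁ : LocallyExtends p π Z₁) (h₂ : LocallyExtends p π Z₂) : LocallyExtends p π Z := by
  intro f
  obtain ⟨s₁, hs₁, g₁, hg₁⟩ := h₁ (LinearMap.fst R Z₁ Z₂ ∘ₗ e.toLinearMap ∘ₗ f)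
  obtain ⟨s₂, hs₂, g₂, hg₂⟩ := h₂ (LinearMap.snd R Z₁ Z₂ ∘ₗ e.toLinearMap ∘ₗ f)
  refine ⟨s₁ * s₂, p.asIdeal.primeCompl.mul_mem hs₁ hs₂,
    e.symm.toLinearMap ∘ₗ (s₂ • g₁).prod (s₁ • g₂), fun x ↦ ?_⟩
  rw [LinearMap.comp_apply, LinearEquiv.coe_coe, LinearEquiv.symm_apply_eq]
  ext <;> simp [hg₁, hg₂, smul_smul, mul_comm]

lemma LocallyExtends.prod_left {E₁ E₂ Y₁ Y₂ : Type*} [AddCommGroup E₁] [Module R E₁]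
    [AddCommGroup E₂] [Module R E₂] [AddCommGroup Y₁] [Module R Y₁]
    [AddCommGroup Y₂] [Module R Y₂] {π₁ : E₁ →ₗ[R] Y₁} {π₂ : E₂ →ₗ[R] Y₂} (e : (Y₁ × Y₂) ≃ₗ[R] Y)
    (h₁ : LocallyExtends p π₁ Z) (h₂ : LocallyExtends p π₂ Z) :
    LocallyExtends p (e.toLinearMap ∘ₗ π₁.prodMap π₂) Z := by
  intro f
  obtain ⟨s₁, hs₁, g₁, hg₁⟩ := h₁ (f ∘ₗ (LinearMap.inl R E₁ E₂).restrict
    (q := LinearMap.ker (e.toLinearMap ∘ₗ π₁.prodMap π₂)) (fun x hx ↦ by simpa using hx))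
  obtain ⟨s₂, hs₂, g₂, hg₂⟩ := h₂ (f ∘ₗ (LinearMap.inr R E₁ E₂).restrict
    (q := LinearMap.ker (e.toLinearMap ∘ₗ π₁.prodMap π₂)) (fun x hx ↦ by simpa using hx))
  refine ⟨s₁ * s₂, p.asIdeal.primeCompl.mul_mem hs₁ hs₂, (s₂ • g₁).coprod (s₁ • g₂), ?_⟩
  rintro ⟨⟨x₁, x₂⟩, hx⟩
  obtain ⟨hx₁, hx₂⟩ : π₁ x₁ = 0 ∧ π₂ x₂ = 0 := by simpa using hx
  have e₁ := hg₁ ⟨x₁, hx₁⟩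
  have e₂ := hg₂ ⟨x₂, hx₂⟩
  dsimp only at e₁ e₂
  rw [LinearMap.coprod_apply, LinearMap.smul_apply, LinearMap.smul_apply, e₁, e₂, smul_smul,
    smul_smul, mul_comm s₂, ← smul_add, LinearMap.comp_apply, LinearMap.comp_apply, ← map_add]
  congr 2
  ext <;> simp

end LinearAlgebra

section Localization

variable {R : Type*} [CommRing R] (S : Submonoid R)

lemma projective_localizedModule_of_smul_section {M F : Type*} [AddCommGroup M]
    [Module R M] [AddCommGroup F] [Module R F] [Module.Projective R F] {s : R} (hs : s ∈ S)
    (π : F →ₗ[R] M) (h : M →ₗ[R] F) (hh : ∀ y, π (h y) = s • y) :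
    Module.Projective (Localization S) (LocalizedModule S M) := by
  have : Module.Projective (Localization S) (LocalizedModule S F) :=
    Module.projective_of_isLocalizedModule S (LocalizedModule.mkLinearMap S F)
  refine Module.Projective.of_split
    (Localization.mk (1 : R) ⟨s, hs⟩ • LocalizedModule.map S h) (LocalizedModule.map S π) ?_
  ext x
  induction x using LocalizedModule.induction_on with
  | h m t =>
    simp only [LinearMap.comp_apply, LinearMap.smul_apply, LocalizedModule.map_mk, hh,
      LocalizedModule.mk_smul_mk, LinearMap.id_apply, one_smul]
    exact LocalizedModule.mk_cancel_common_left ⟨s, hs⟩ t m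

lemma exists_smul_section_of_projective_localizedModule {M F : Type*} [AddCommGroup M]
    [Module R M] [AddCommGroup F] [Module R F] [Module.FinitePresentation R M]
    [Module.Projective (Localization S) (LocalizedModule S M)]
    (π : F →ₗ[R] M) (hπ : Function.Surjective π) :
    ∃ s ∈ S, ∃ h : M →ₗ[R] F, ∀ y, π (h y) = s • y := by
  obtain ⟨σ, hσ⟩ := Module.projective_lifting_property (LocalizedModule.map S π) LinearMap.id
    (LocalizedModule.map_surjective S π hπ)
  obtain ⟨h, s, hs⟩ := Module.FinitePresentation.exists_lift_of_isLocalizedModule S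
    (LocalizedModule.mkLinearMap S F)
    ((σ.restrictScalars R) ∘ₗ LocalizedModule.mkLinearMap S M)
  obtain ⟨t, ht⟩ := Module.Finite.exists_smul_of_comp_eq_of_isLocalizedModule S
    (LocalizedModule.mkLinearMap S M) (π ∘ₗ h) ((s : R) • LinearMap.id) (by
      ext y
      have hy := LinearMap.congr_fun hs y
      have h₁ : LocalizedModule.mkLinearMap S M (π (h y)) =
          LocalizedModule.map S π (LocalizedModule.mkLinearMap S F (h y)) := by
        simp
      have h₂ := LinearMap.congr_fun hσ (LocalizedModule.mkLinearMap S M y)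
      simp only [LinearMap.comp_apply, LinearMap.smul_apply] at hy
      simp only [LinearMap.comp_apply, LinearMap.id_apply] at h₂
      rw [LinearMap.comp_apply, LinearMap.comp_apply, h₁, hy]
      simp only [LinearMap.comp_apply, LinearMap.restrictScalars_apply, LinearMap.smul_apply,
        LinearMap.id_apply, map_smul]
      rw [Submonoid.smul_def, LinearMap.map_smul_of_tower, h₂])
  refine ⟨t * s, S.mul_mem t.2 s.2, (t : R) • h, fun y ↦ ?_⟩
  simpa [smul_smul, Submonoid.smul_def] using LinearMap.congr_fun ht y

end Localization

section Ext

open Opposite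

variable {R : Type} [CommRing R]

lemma notMem_support_homology_iff (S : ShortComplex (ModuleCat.{0} R)) (p : PrimeSpectrum R) :
    p ∉ Module.support R S.homology ↔
      ∀ x : S.X₂, S.g x = 0 → ∃ s ∉ p.asIdeal, ∃ y : S.X₁, S.f y = s • x := by
  rw [S.moduleCatHomologyIso.toLinearEquiv.support_eq, Module.notMem_support_iff']
  constructor
  · intro h x hx
    obtain ⟨s, hs, h⟩ := h (Submodule.Quotient.mk ⟨x, hx⟩)
    obtain ⟨y, hy⟩ := (Submodule.Quotient.mk_eq_zero (LinearMap.range S.moduleCatToCycles)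
      (x := s • (⟨x, hx⟩ : LinearMap.ker S.g.hom))).1 h
    exact ⟨s, hs, y, congrArg Subtype.val hy⟩
  · intro h m
    obtain ⟨⟨x, hx⟩, rfl⟩ := Submodule.Quotient.mk_surjective _ m
    obtain ⟨s, hs, y, hy⟩ := h x hx
    exact ⟨s, hs, (Submodule.Quotient.mk_eq_zero (LinearMap.range S.moduleCatToCycles)
      (x := s • (⟨x, hx⟩ : LinearMap.ker S.g.hom))).2 ⟨y, Subtype.ext hy⟩⟩

lemma notMem_support_ext_one_iff {Y : ModuleCat.{0} R} (P : ProjectiveResolution Y)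
    (Z : ModuleCat.{0} R) (p : PrimeSpectrum R) :
    p ∉ Module.support R (((Ext R (ModuleCat R) 1).obj (op Y)).obj Z) ↔
      ∀ x : P.complex.X 1 ⟶ Z, P.complex.d 2 1 ≫ x = 0 →
        ∃ s ∉ p.asIdeal, ∃ y : P.complex.X 0 ⟶ Z, P.complex.d 1 0 ≫ y = s • x := by
  rw [(P.isoExt 1 Z ≪≫ (P.complex.linearYonedaObj R Z).homologyIsoSc' 0 1 2 (by simp)
    (by simp)).toLinearEquiv.support_eq, notMem_support_homology_iff]
  rfl

lemma notMem_support_ext_one_iff_locallyExtends_resolution {Y : ModuleCat.{0} R}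
    (P : ProjectiveResolution Y) (Z : ModuleCat.{0} R) (p : PrimeSpectrum R) :
    p ∉ Module.support R (((Ext R (ModuleCat R) 1).obj (op Y)).obj Z) ↔
      LocallyExtends p (P.π.f 0).hom Z := by
  rw [notMem_support_ext_one_iff P]
  have h₁ := (P.exact_succ 0).moduleCat_range_eq_ker
  have h₀ := P.exact₀.moduleCat_range_eq_ker
  dsimp only at h₀ h₁
  let q : P.complex.X 1 →ₗ[R] LinearMap.ker (P.π.f 0).hom :=
    (P.complex.d 1 0).hom.codRestrict _ (fun x ↦ h₀ ▸ LinearMap.mem_range_self _ x)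
  have hq : Function.Surjective q := by
    rintro ⟨k, hk⟩
    obtain ⟨u, hu⟩ := h₀.symm ▸ hk
    exact ⟨u, Subtype.ext hu⟩
  constructor
  · intro h f
    obtain ⟨s, hs, y, hy⟩ := h (ModuleCat.ofHom (f ∘ₗ q)) (by
      ext u
      have hu : q ((P.complex.d 2 1).hom u) = 0 :=
        Subtype.ext (h₁.le (LinearMap.mem_range_self _ u))
      exact (congrArg f hu).trans (map_zero f))
    refine ⟨s, hs, y.hom, fun k ↦ ?_⟩
    obtain ⟨u, rfl⟩ := hq k
    exact LinearMap.congr_fun (congrArg ModuleCat.Hom.hom hy) u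
  · intro h x hx
    obtain ⟨f, hf⟩ := exists_comp_eq_of_surjective q hq x.hom (fun a ha ↦ by
      obtain ⟨b, rfl⟩ := h₁.ge (show a ∈ LinearMap.ker _ from congrArg Subtype.val ha)
      exact LinearMap.congr_fun (congrArg ModuleCat.Hom.hom hx) b)
    obtain ⟨s, hs, g, hg⟩ := h f
    refine ⟨s, hs, ModuleCat.ofHom g, ?_⟩
    ext a
    exact (hg (q a)).trans (congrArg (s • ·) (hf a))

lemma notMem_support_ext1_iff_s5 {F : Type} [AddCommGroup F] [Module R F] [Module.Projective R F]
    {Y Z : ModuleCat.{0} R} (π : F →ₗ[R] Y) (hπ : Function.Surjective π) (p : PrimeSpectrum R) :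
    p ∉ Module.support R (ext1 R Y Z) ↔ LocallyExtends p π Z := by
  let P := projectiveResolution Y
  rw [ext1, notMem_support_ext_one_iff_locallyExtends_resolution P]
  have : Module.Projective R (P.complex.X 0) :=
    (IsProjective.iff_projective _).2 (P.projective 0)
  have hP : Function.Surjective (P.π.f 0).hom := (ModuleCat.epi_iff_surjective _).1 inferInstance
  exact ⟨fun h ↦ h.of_projective hP hπ, fun h ↦ h.of_projective hπ hP⟩

lemma notMem_support_ext1_of_equiv_prod {F G : Type} [AddCommGroup F] [Module R F]
    [Module.Projective R F] [AddCommGroup G] [Module R G] [Module.Projective R G]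
    {Y A B Z : ModuleCat.{0} R} (e : Y ≃ₗ[R] A × B) {π : F →ₗ[R] A} (hπ : Function.Surjective π)
    {ρ : G →ₗ[R] B} (hρ : Function.Surjective ρ) {p : PrimeSpectrum R}
    (hA : p ∉ Module.support R (ext1 R A Z)) (hB : p ∉ Module.support R (ext1 R B Z)) :
    p ∉ Module.support R (ext1 R Y Z) := by
  rw [notMem_support_ext1_iff_s5 π hπ] at hA
  rw [notMem_support_ext1_iff_s5 ρ hρ] at hB
  have hsurj : Function.Surjective (e.symm.toLinearMap ∘ₗ π.prodMap ρ) :=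
    e.symm.surjective.comp (hπ.prodMap hρ)
  exact (notMem_support_ext1_iff_s5 _ hsurj p).2 (hA.prod_left e.symm hB)

end Ext

section NonfreeLocus

variable {R : Type} [CommRing R]

lemma notMem_nonfreeLocus_iff (p : PrimeSpectrum R) (M : ModuleCat.{0} R) [Module.Finite R M] :
    p ∉ nonfreeLocus R M ↔ Module.Projective (Localization.AtPrime p.asIdeal)
      (LocalizedModule p.asIdeal.primeCompl M) := by
  have : Module.Finite (Localization.AtPrime p.asIdeal)
      (LocalizedModule p.asIdeal.primeCompl M) :=
    Module.Finite.of_isLocalizedModule p.asIdeal.primeCompl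
      (LocalizedModule.mkLinearMap p.asIdeal.primeCompl M)
  rw [nonfreeLocus, Set.mem_ofPred_eq, not_not]
  exact ⟨fun _ ↦ Module.Projective.of_free, fun _ ↦
    have := Module.Flat.of_projective (R := Localization.AtPrime p.asIdeal)
      (M := LocalizedModule p.asIdeal.primeCompl M)
    Module.free_of_flat_of_isLocalRing⟩

lemma IsSummand.of_iso {M N : ModuleCat.{0} R} (e : M ≅ N) : IsSummand R N M :=
  ⟨e.inv, e.hom, e.inv_hom_id⟩

lemma IsSummand.projective_localizedModule {M N : ModuleCat.{0} R} (h : IsSummand R N M)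
    (S : Submonoid R) [Module.Projective (Localization S) (LocalizedModule S M)] :
    Module.Projective (Localization S) (LocalizedModule S N) := by
  obtain ⟨i, q, hiq⟩ := h
  refine Module.Projective.of_split (LocalizedModule.map S i.hom) (LocalizedModule.map S q.hom) ?_
  ext x
  induction x using LocalizedModule.induction_on with
  | h m t =>
    have hm : q.hom (i.hom m) = m := LinearMap.congr_fun (congrArg ModuleCat.Hom.hom hiq) m
    simp [LocalizedModule.map_mk, hm]

lemma IsSummand.finite {M N : ModuleCat.{0} R} (h : IsSummand R N M) [Module.Finite R M] :
    Module.Finite R N := by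
  obtain ⟨i, q, hiq⟩ := h
  exact Module.Finite.of_surjective q.hom
    fun n ↦ ⟨i.hom n, LinearMap.congr_fun (congrArg ModuleCat.Hom.hom hiq) n⟩

lemma isResolving_projective_localizedModule [IsNoetherianRing R] (S : Submonoid R) :
    IsResolving R {M : ModuleCat.{0} R | Module.Finite R M ∧
      Module.Projective (Localization S) (LocalizedModule S M)} where
  finite _ h := h.1
  iso_closed M N := by
    rintro ⟨e⟩ ⟨_, _⟩
    exact ⟨(IsSummand.of_iso e).finite, (IsSummand.of_iso e).projective_localizedModule S⟩
  proj_mem M h _ :=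
    ⟨h, Module.projective_of_isLocalizedModule S (LocalizedModule.mkLinearMap S M)⟩
  summand_closed M N h := by
    rintro ⟨_, _⟩
    exact ⟨h.finite, h.projective_localizedModule S⟩
  ext_closed L M N := by
    rintro ⟨f, g, hf, hg, hfg⟩ ⟨_, _⟩ ⟨_, _⟩
    refine ⟨Module.Finite.of_exact hfg hg, ?_⟩
    have hex : Function.Exact (LocalizedModule.map S f.hom) (LocalizedModule.map S g.hom) :=
      LocalizedModule.map_exact S f.hom g.hom hfg
    obtain ⟨σ, hσ⟩ := Module.projective_lifting_property (LocalizedModule.map S g.hom)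
      LinearMap.id (LocalizedModule.map_surjective S g.hom hg)
    obtain ⟨e, -⟩ := (hex.split_tfae'.out 0 2 :).1
      ⟨LocalizedModule.map_injective S f.hom hf, σ, hσ⟩
    exact Module.Projective.of_equiv e.symm
  ker_epi_closed L M N := by
    rintro ⟨f, g, hf, hg, hfg⟩ ⟨_, _⟩ ⟨_, _⟩
    refine ⟨Module.Finite.of_injective f.hom hf, ?_⟩
    have hex : Function.Exact (LocalizedModule.map S f.hom) (LocalizedModule.map S g.hom) :=
      LocalizedModule.map_exact S f.hom g.hom hfg
    obtain ⟨σ, hσ⟩ := Module.projective_lifting_property (LocalizedModule.map S g.hom)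
      LinearMap.id (LocalizedModule.map_surjective S g.hom hg)
    obtain ⟨-, τ, hτ⟩ := (hex.split_tfae'.out 0 1 :).1
      ⟨LocalizedModule.map_injective S f.hom hf, σ, hσ⟩
    exact Module.Projective.of_split _ τ hτ

lemma isResolving_finite [IsNoetherianRing R] :
    IsResolving R {M : ModuleCat.{0} R | Module.Finite R M} where
  finite _ h := h
  iso_closed M N := by
    rintro ⟨e⟩ (_ : Module.Finite R M)
    exact (IsSummand.of_iso e).finite
  proj_mem _ h _ := h
  summand_closed M N h (_ : Module.Finite R M) := h.finite
  ext_closed L M N := by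
    rintro ⟨f, g, hf, hg, hfg⟩ (_ : Module.Finite R L) (_ : Module.Finite R N)
    exact Module.Finite.of_exact hfg hg
  ker_epi_closed L M N := by
    rintro ⟨f, g, hf, hg, hfg⟩ (_ : Module.Finite R M) -
    exact Module.Finite.of_injective f.hom hf

lemma isResolving_resClosure [IsNoetherianRing R] {𝒳 : Set (ModuleCat.{0} R)}
    (h𝒳 : ∀ X ∈ 𝒳, Module.Finite R X) : IsResolving R (resClosure R 𝒳) where
  finite _ hM := hM _ ⟨isResolving_finite, h𝒳⟩
  iso_closed M N e hM := fun 𝒴 h𝒴 ↦ h𝒴.1.iso_closed M N e (hM 𝒴 h𝒴)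
  proj_mem M h h' := fun _ h𝒴 ↦ h𝒴.1.proj_mem M h h'
  summand_closed M N h hM := fun 𝒴 h𝒴 ↦ h𝒴.1.summand_closed M N h (hM 𝒴 h𝒴)
  ext_closed L M N h hL hN := fun 𝒴 h𝒴 ↦ h𝒴.1.ext_closed L M N h (hL 𝒴 h𝒴) (hN 𝒴 h𝒴)
  ker_epi_closed L M N h hM hN := fun 𝒴 h𝒴 ↦
    h𝒴.1.ker_epi_closed L M N h (hM 𝒴 h𝒴) (hN 𝒴 h𝒴)

lemma subset_resClosure (𝒳 : Set (ModuleCat.{0} R)) : 𝒳 ⊆ resClosure R 𝒳 :=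
  fun _ hX _ h𝒴 ↦ h𝒴.2 hX

/-- The Krull–Schmidt style induction principle: a property of finitely generated modules in a
resolving class which holds for indecomposable modules and passes to direct sums holds for all. -/
lemma IsResolving.induction_indec [IsNoetherianRing R] {𝒴 : Set (ModuleCat.{0} R)}
    (h𝒴 : IsResolving R 𝒴) {P : ModuleCat.{0} R → Prop}
    (zero : ∀ M : ModuleCat.{0} R, Subsingleton M → P M)
    (indec : ∀ M ∈ 𝒴, Indec R M → P M)
    (prod : ∀ M A B : ModuleCat.{0} R, (M ≃ₗ[R] A × B) → P A → P B → P M)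
    (M : ModuleCat.{0} R) (hM : M ∈ 𝒴) : P M := by
  have := h𝒴.finite M hM
  suffices ∀ (K : Submodule R M) (N : ModuleCat.{0} R), N ∈ 𝒴 →
      ∀ q : M →ₗ[R] N, Function.Surjective q → LinearMap.ker q = K → P N from
    this _ M hM LinearMap.id Function.surjective_id rfl
  intro K
  induction K using WellFoundedGT.induction with
  | ind K ih =>
    rintro N hN q hq rfl
    rcases subsingleton_or_nontrivial N with hN₀ | hN₀
    · exact zero N hN₀
    by_cases hind : Indec R N
    · exact indec N hN hind
    simp only [Indec, hN₀, true_and, not_forall, not_isEmpty_iff] at hind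
    obtain ⟨A, B, hA, hB, ⟨e⟩⟩ := hind
    let e' : N ≃ₗ[R] A × B := e.toLinearEquiv
    refine prod N A B e' ?_ ?_
    · refine ih (LinearMap.ker (LinearMap.fst R A B ∘ₗ e'.toLinearMap ∘ₗ q)) ?_ A
        (h𝒴.summand_closed N A ⟨ModuleCat.ofHom (e'.symm.toLinearMap ∘ₗ LinearMap.inl R A B),
          ModuleCat.ofHom (LinearMap.fst R A B ∘ₗ e'.toLinearMap), by ext; simp⟩ hN) _
        (Prod.fst_surjective.comp (e'.surjective.comp hq)) rfl
      refine lt_of_le_of_ne (fun x hx ↦ by simp [LinearMap.mem_ker.1 hx]) fun h ↦ ?_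
      obtain ⟨b, hb⟩ := exists_ne (0 : B)
      obtain ⟨x, hx⟩ := hq (e'.symm (0, b))
      have hx' : x ∈ LinearMap.ker q := h ▸ (by simp [hx])
      rw [LinearMap.mem_ker.1 hx', eq_comm, LinearEquiv.map_eq_zero_iff] at hx
      exact hb (congrArg Prod.snd hx)
    · refine ih (LinearMap.ker (LinearMap.snd R A B ∘ₗ e'.toLinearMap ∘ₗ q)) ?_ B
        (h𝒴.summand_closed N B ⟨ModuleCat.ofHom (e'.symm.toLinearMap ∘ₗ LinearMap.inr R A B),
          ModuleCat.ofHom (LinearMap.snd R A B ∘ₗ e'.toLinearMap), by ext; simp⟩ hN) _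
        (Prod.snd_surjective.comp (e'.surjective.comp hq)) rfl
      refine lt_of_le_of_ne (fun x hx ↦ by simp [LinearMap.mem_ker.1 hx]) fun h ↦ ?_
      obtain ⟨a, ha⟩ := exists_ne (0 : A)
      obtain ⟨x, hx⟩ := hq (e'.symm (a, 0))
      have hx' : x ∈ LinearMap.ker q := h ▸ (by simp [hx])
      rw [LinearMap.mem_ker.1 hx', eq_comm, LinearEquiv.map_eq_zero_iff] at hx
      exact ha (congrArg Prod.fst hx)

lemma notMem_nonfreeLocus_of_notMem_nonfreeLocusSet [IsNoetherianRing R]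
    {𝒳 : Set (ModuleCat.{0} R)} (h𝒳 : ∀ X ∈ 𝒳, Module.Finite R X) {p : PrimeSpectrum R}
    (hp : p ∉ nonfreeLocusSet R 𝒳) {Y : ModuleCat.{0} R} (hY : Y ∈ resClosure R 𝒳) :
    p ∉ nonfreeLocus R Y := by
  have h := hY _ ⟨isResolving_projective_localizedModule p.asIdeal.primeCompl, fun X hX ↦ by
    have := h𝒳 X hX
    exact ⟨this, (notMem_nonfreeLocus_iff p X).1 fun h ↦ hp (Set.mem_biUnion hX h)⟩⟩
  have := h.1
  exact (notMem_nonfreeLocus_iff p Y).2 h.2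

lemma support_ext1_subset_nonfreeLocus [IsNoetherianRing R] (Y Z : ModuleCat.{0} R)
    [Module.Finite R Y] : Module.support R (ext1 R Y Z) ⊆ nonfreeLocus R Y := by
  intro p
  contrapose
  intro hp
  have := (notMem_nonfreeLocus_iff p Y).1 hp
  have hπ := Finsupp.linearCombination_id_surjective R Y
  have := Module.finitePresentation_of_finite R Y
  obtain ⟨s, hs, h, hh⟩ :=
    exists_smul_section_of_projective_localizedModule p.asIdeal.primeCompl _ hπ
  exact (notMem_support_ext1_iff_s5 _ hπ p).2 (.of_smul_section hs hh)

lemma notMem_support_ext1_of_indec [IsNoetherianRing R] {𝒴 : Set (ModuleCat.{0} R)}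
    (h𝒴 : IsResolving R 𝒴) {p : PrimeSpectrum R}
    (h : ∀ Y ∈ 𝒴, Indec R Y → ∀ Z ∈ 𝒴, Indec R Z → p ∉ Module.support R (ext1 R Y Z))
    {Y Z : ModuleCat.{0} R} (hY : Y ∈ 𝒴) (hZ : Z ∈ 𝒴) :
    p ∉ Module.support R (ext1 R Y Z) := by
  have one_notMem : (1 : R) ∉ p.asIdeal := p.asIdeal.primeCompl.one_mem
  have hπ (M : ModuleCat.{0} R) := Finsupp.linearCombination_id_surjective R M
  refine h𝒴.induction_indec (P := fun Y ↦ p ∉ Module.support R (ext1 R Y Z)) ?_ ?_ ?_ Y hY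
  · intro M _
    exact (notMem_support_ext1_iff_s5 (0 : M →ₗ[R] M) (Function.surjective_to_subsingleton _) p).2
      (.of_smul_section one_notMem (h := 0) fun _ ↦ Subsingleton.elim _ _)
  · intro M hM hM'
    refine h𝒴.induction_indec (P := fun Z ↦ p ∉ Module.support R (ext1 R M Z)) ?_ (h M hM hM') ?_
      Z hZ
    · intro N _
      exact (notMem_support_ext1_iff_s5 _ (hπ M) p).2
        fun f ↦ ⟨1, one_notMem, 0, fun _ ↦ Subsingleton.elim _ _⟩
    · intro N A B e hA hB
      rw [notMem_support_ext1_iff_s5 _ (hπ M)] at hA hB ⊢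
      exact hA.prod_right e hB
  · intro M A B e hA hB
    exact notMem_support_ext1_of_equiv_prod e (hπ A) (hπ B) hA hB

lemma notMem_nonfreeLocus_of_indec [IsNoetherianRing R] {𝒴 : Set (ModuleCat.{0} R)}
    (h𝒴 : IsResolving R 𝒴) {p : PrimeSpectrum R}
    (h : ∀ Y ∈ 𝒴, Indec R Y → ∀ Z ∈ 𝒴, Indec R Z → p ∉ Module.support R (ext1 R Y Z))
    {X : ModuleCat.{0} R} (hX : X ∈ 𝒴) : p ∉ nonfreeLocus R X := by
  have := h𝒴.finite X hX
  obtain ⟨n, π, hπ⟩ := Module.Finite.exists_fin' R X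
  have hK : ModuleCat.of R (LinearMap.ker π) ∈ 𝒴 :=
    h𝒴.ker_epi_closed _ (ModuleCat.of R (Fin n → R)) X
      ⟨ModuleCat.ofHom (LinearMap.ker π).subtype, ModuleCat.ofHom π,
        Subtype.val_injective, hπ, LinearMap.exact_subtype_ker_map π⟩
      (h𝒴.proj_mem _ (inferInstanceAs (Module.Finite R (Fin n → R)))
        (inferInstanceAs (Module.Projective R (Fin n → R)))) hX
  obtain ⟨s, hs, σ, hσ⟩ := LocallyExtends.exists_smul_section hπ
    ((notMem_support_ext1_iff_s5 π hπ p).1 (notMem_support_ext1_of_indec h𝒴 h hX hK))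
  exact (notMem_nonfreeLocus_iff p X).2
    (projective_localizedModule_of_smul_section p.asIdeal.primeCompl hs π σ hσ)

end NonfreeLocus

/-- `NF(𝒳)` is the union of `Supp (Ext¹_R(Y, Z))` over all pairs of
indecomposable modules `Y, Z` in the resolving closure of `𝒳`. -/
theorem stmt5 (R : Type) [CommRing R] [IsNoetherianRing R]
    (𝒳 : Set (ModuleCat R)) (h𝒳 : ∀ X ∈ 𝒳, Module.Finite R X) :
    nonfreeLocusSet R 𝒳 =
      ⋃ Y ∈ resClosure R 𝒳, ⋃ (_ : Indec R Y),
        ⋃ Z ∈ resClosure R 𝒳, ⋃ (_ : Indec R Z),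
          Module.support R ↥(ext1 R Y Z) := by
  have hres := isResolving_resClosure h𝒳
  ext p
  constructor
  · contrapose
    simp only [Set.mem_iUnion, not_exists]
    intro h
    simp only [nonfreeLocusSet, Set.mem_iUnion, not_exists]
    intro X hX
    exact notMem_nonfreeLocus_of_indec hres
      (fun Y hY hY' Z hZ hZ' ↦ h Y hY hY' Z hZ hZ') (subset_resClosure 𝒳 hX)
  · simp only [Set.mem_iUnion]
    rintro ⟨Y, hY, -, Z, -, -, hp⟩
    by_contra hp'
    have := hres.finite Y hY
    exact notMem_nonfreeLocus_of_notMem_nonfreeLocusSet h𝒳 hp' hY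
      (support_ext1_subset_nonfreeLocus Y Z hp)
end

section
/- Let (R, m) be a commutative noetherian local ring, let 0 → L →^f M → N → 0 be a short exact sequence of finitely generated R-modules, and let x ∈ m. Then the R-linear map L → L ⊕ M sending l to (x·l, f(l)) is injective, and if this map admits an R-linear left inverse (retraction), then f admits an R-linear left inverse, i.e., the original short exact sequence splits. -/
open CategoryTheory

/-- On a finite module over a local ring, an endomorphism congruent to the identity modulo an
element of the maximal ideal is bijective. -/
theorem LinearMap.bijective_of_smul_add_eq_self {R L : Type*} [CommRing R] [IsLocalRing R]
    [AddCommGroup L] [Module R L] [Module.Finite R L] {x : R}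
    (hx : x ∈ IsLocalRing.maximalIdeal R) (a e : L →ₗ[R] L) (h : ∀ l, x • a l + e l = l) :
    Function.Bijective e := by
  refine OrzechProperty.bijective_of_surjective_endomorphism e (LinearMap.range_eq_top.1 ?_)
  refine top_le_iff.1 (Submodule.le_of_le_smul_of_le_jacobson_bot Module.Finite.fg_top
    (IsLocalRing.maximalIdeal_le_jacobson ⊥) fun l _ => ?_)
  rw [← h l, add_comm]
  exact Submodule.add_mem_sup (LinearMap.mem_range_self e l)
    (Submodule.smul_mem_smul hx Submodule.mem_top)

/-- Over a noetherian local ring `(R, 𝔪)`, given a short exact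
sequence `0 → L →f M → N → 0` of finitely generated modules and `x ∈ 𝔪`, the map
`L → L ⊕ M`, `l ↦ (x·l, f l)` is injective, and if it admits a retraction then `f`
admits a retraction (i.e. the original sequence splits). -/
theorem stmt6 (R : Type) [CommRing R] [IsNoetherianRing R] [IsLocalRing R]
    (L M N : Type) [AddCommGroup L] [AddCommGroup M] [AddCommGroup N]
    [Module R L] [Module R M] [Module R N]
    (hL : Module.Finite R L) (hM : Module.Finite R M) (hN : Module.Finite R N)
    (f : L →ₗ[R] M) (g : M →ₗ[R] N)
    (hf : Function.Injective f) (hg : Function.Surjective g)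
    (hfg : Function.Exact f g)
    (x : R) (hx : x ∈ IsLocalRing.maximalIdeal R) :
    Function.Injective (LinearMap.prod (x • (LinearMap.id : L →ₗ[R] L)) f) ∧
      ((∃ r : L × M →ₗ[R] L,
          r ∘ₗ LinearMap.prod (x • (LinearMap.id : L →ₗ[R] L)) f = LinearMap.id) →
        ∃ s : M →ₗ[R] L, s ∘ₗ f = LinearMap.id) := by
  refine ⟨fun a b h => hf (congrArg Prod.snd h), fun ⟨r, hr⟩ => ?_⟩
  let b : M →ₗ[R] L := r ∘ₗ LinearMap.inr R L M
  have he : Function.Bijective (b ∘ₗ f) := by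
    refine LinearMap.bijective_of_smul_add_eq_self hx (r ∘ₗ LinearMap.inl R L M) _ fun l => ?_
    have hl : r (x • l, f l) = l := LinearMap.congr_fun hr l
    simpa [b, ← map_smul, ← map_add] using hl
  exact ⟨(LinearEquiv.ofBijective _ he).symm ∘ₗ b,
    LinearMap.ext (LinearEquiv.ofBijective _ he).symm_apply_apply⟩
end

section
/- Let (R, m) be a commutative noetherian local ring, X a finitely generated R-module, p a prime ideal in NF(X), and x an element of p. Then there exist a short exact sequence 0 → K → R^n → X → 0 of finitely generated R-modules and a finitely generated R-module X₁ fitting into a short exact sequence 0 → K → X₁ → X → 0 such that: (1) X₁ belongs to res² X; (2) V(p) ⊆ NF(X₁) ⊆ NF(X); and (3) no prime ideal of NF(X₁) omits x, i.e., D(x) ∩ NF(X₁) = ∅. -/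
open CategoryTheory

noncomputable section

variable (R : Type) [CommRing R]

section ScaledPullback

variable {R K F X Y : Type*} [CommRing R]
  [AddCommGroup K] [AddCommGroup F] [AddCommGroup X] [AddCommGroup Y]
  [Module R K] [Module R F] [Module R X] [Module R Y]

/-- The short exact sequence `0 → K → Y → X → 0` given by `i` and `s` is the pullback, along
multiplication by `x`, of the short exact sequence `0 → K → F → X → 0` given by `ι` and `π`. -/
structure IsScaledPullback (x : R) (ι : K →ₗ[R] F) (π : F →ₗ[R] X)
    (i : K →ₗ[R] Y) (s : Y →ₗ[R] X) (j : Y →ₗ[R] F) : Prop where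
  injective_ι : Function.Injective ι
  exact_ι_π : Function.Exact ι π
  surjective_π : Function.Surjective π
  injective_i : Function.Injective i
  exact_i_s : Function.Exact i s
  surjective_s : Function.Surjective s
  j_i : ∀ k, j (i k) = ι k
  π_j : ∀ y, π (j y) = x • s y

/-- The kernel of `(f, y) ↦ π f - x • y` is the pullback of `π` along multiplication by `x`. -/
theorem isScaledPullback_ker (x : R) (π : F →ₗ[R] X) (hπ : Function.Surjective π) :
    IsScaledPullback x (LinearMap.ker π).subtype π
      (((LinearMap.inl R F X) ∘ₗ (LinearMap.ker π).subtype).codRestrict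
        (LinearMap.ker (π.coprod (-x • LinearMap.id))) (fun k => by simp))
      (LinearMap.snd R F X ∘ₗ (LinearMap.ker (π.coprod (-x • LinearMap.id))).subtype)
      (LinearMap.fst R F X ∘ₗ (LinearMap.ker (π.coprod (-x • LinearMap.id))).subtype) where
  injective_ι := Subtype.val_injective
  exact_ι_π := LinearMap.exact_subtype_ker_map π
  surjective_π := hπ
  injective_i _ _ h := Subtype.ext (congrArg (fun z => z.1.1) h)
  exact_i_s := by
    rintro ⟨⟨f, y⟩, h⟩
    constructor
    · intro hy
      obtain rfl : y = 0 := hy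
      exact ⟨⟨f, by simpa using h⟩, rfl⟩
    · rintro ⟨k, hk⟩
      exact (congrArg (fun z => z.1.2) hk).symm
  surjective_s y := by
    obtain ⟨f, hf⟩ := hπ (x • y)
    exact ⟨⟨(f, y), by simp [hf]⟩, rfl⟩
  j_i _ := rfl
  π_j := by
    rintro ⟨⟨f, y⟩, h⟩
    simpa [add_neg_eq_zero] using h

namespace IsScaledPullback

variable {x : R} {ι : K →ₗ[R] F} {π : F →ₗ[R] X}
  {i : K →ₗ[R] Y} {s : Y →ₗ[R] X} {j : Y →ₗ[R] F}

theorem localizedModule (h : IsScaledPullback x ι π i s j) (S : Submonoid R) :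
    IsScaledPullback (algebraMap R (Localization S) x) (LocalizedModule.map S ι)
      (LocalizedModule.map S π) (LocalizedModule.map S i) (LocalizedModule.map S s)
      (LocalizedModule.map S j) where
  injective_ι := LocalizedModule.map_injective S ι h.injective_ι
  exact_ι_π := LocalizedModule.map_exact S ι π h.exact_ι_π
  surjective_π := LocalizedModule.map_surjective S π h.surjective_π
  injective_i := LocalizedModule.map_injective S i h.injective_i
  exact_i_s := LocalizedModule.map_exact S i s h.exact_i_s
  surjective_s := LocalizedModule.map_surjective S s h.surjective_s
  j_i k := by
    induction k using LocalizedModule.induction_on with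
    | h k t => simp [h.j_i]
  π_j y := by
    induction y using LocalizedModule.induction_on with
    | h y t => simp [h.π_j, LocalizedModule.smul'_mk]

/-- If `x` is a unit, then pulling back along multiplication by `x` changes nothing. -/
theorem bijective_j (h : IsScaledPullback x ι π i s j) (hx : IsUnit x) :
    Function.Bijective j := by
  constructor
  · rw [injective_iff_map_eq_zero]
    intro e he
    have hs : s e = 0 := by
      rw [← hx.smul_eq_zero, ← h.π_j, he, map_zero]
    obtain ⟨k, rfl⟩ := (h.exact_i_s e).mp hs
    rw [h.j_i] at he
    rw [(map_eq_zero_iff ι h.injective_ι).mp he, map_zero]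
  · intro f
    obtain ⟨u, rfl⟩ := hx
    obtain ⟨e, he⟩ := h.surjective_s ((u⁻¹ : Rˣ) • π f)
    have hz : π (f - j e) = 0 := by
      rw [map_sub, h.π_j, he]
      change _ - u • (u⁻¹ • π f) = 0
      rw [smul_inv_smul, sub_self]
    obtain ⟨k, hk⟩ := (h.exact_ι_π _).mp hz
    exact ⟨e + i k, by rw [map_add, h.j_i, hk]; abel⟩

theorem projective (h : IsScaledPullback x ι π i s j) [Module.Projective R F]
    [Module.Projective R X] : Module.Projective R Y := by
  obtain ⟨σ, hσ⟩ := Module.projective_lifting_property π LinearMap.id h.surjective_π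
  obtain ⟨τ, hτ⟩ := Module.projective_lifting_property s LinearMap.id h.surjective_s
  have hK : Module.Projective R (K × X) :=
    .of_equiv (h.exact_ι_π.splitSurjectiveEquiv h.injective_ι ⟨σ, hσ⟩).1
  exact .of_equiv (h.exact_i_s.splitSurjectiveEquiv h.injective_i ⟨τ, hτ⟩).1.symm

theorem exists_of_mem_smul_top (h : IsScaledPullback x ι π i s j) (I : Ideal R) {e : Y}
    (he : e ∈ I • (⊤ : Submodule R Y)) :
    ∃ k ∈ I • (⊤ : Submodule R K), ∃ f, j e = ι k + x • f ∧ s e = π f := by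
  induction he using Submodule.smul_induction_on' with
  | smul r hr e _ =>
    obtain ⟨f, hf⟩ := h.surjective_π (s e)
    have hz : π (j e - x • f) = 0 := by
      rw [map_sub, h.π_j, map_smul, hf, sub_self]
    obtain ⟨k, hk⟩ := (h.exact_ι_π _).mp hz
    refine ⟨r • k, Submodule.smul_mem_smul hr trivial, r • f, ?_, by rw [map_smul, map_smul, hf]⟩
    rw [map_smul, map_smul, hk, smul_comm x r f, ← smul_add, sub_add_cancel]
  | add a _ b _ ha hb =>
    obtain ⟨k, hk, f, h₁, h₂⟩ := ha
    obtain ⟨k', hk', f', h₁', h₂'⟩ := hb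
    refine ⟨k + k', add_mem hk hk', f + f', ?_, by rw [map_add, map_add, h₂, h₂']⟩
    rw [map_add, map_add, h₁, h₁', smul_add]
    abel

theorem mem_smul_top_of_map_mem (h : IsScaledPullback x ι π i s j) {I : Ideal R} (hx : x ∈ I)
    {k : K} (hk : i k ∈ I • (⊤ : Submodule R Y)) : k ∈ I • (⊤ : Submodule R K) := by
  obtain ⟨k₁, hk₁, f, hj, hs⟩ := h.exists_of_mem_smul_top I hk
  rw [h.exact_i_s.apply_apply_eq_zero] at hs
  obtain ⟨k₂, rfl⟩ := (h.exact_ι_π f).mp hs.symm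
  rw [h.j_i, ← map_smul, ← map_add] at hj
  rw [h.injective_ι hj]
  exact add_mem hk₁ (Submodule.smul_mem_smul hx trivial)

theorem free_of_mem_maximalIdeal [IsLocalRing R] (h : IsScaledPullback x ι π i s j)
    (hx : x ∈ IsLocalRing.maximalIdeal R) [Module.Finite R K] [Module.Finite R Y]
    [Module.Free R Y] : Module.Free R X := by
  refine Module.free_of_lTensor_residueField_injective i s h.surjective_s h.exact_i_s ?_
  rw [injective_iff_map_eq_zero]
  intro z hz
  obtain ⟨k, rfl⟩ := TensorProduct.mk_surjective R K (IsLocalRing.ResidueField R)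
    IsLocalRing.residue_surjective z
  have hk : i k ∈ IsLocalRing.maximalIdeal R • (⊤ : Submodule R Y) := by
    rw [← Submodule.Quotient.mk_eq_zero, ← TensorProduct.quotTensorEquivQuotSMul_mk_one_tmul]
    exact (LinearEquiv.map_eq_zero_iff _).mpr hz
  have hk' := h.mem_smul_top_of_map_mem hx hk
  rw [← Submodule.Quotient.mk_eq_zero, ← TensorProduct.quotTensorEquivQuotSMul_mk_one_tmul] at hk'
  exact (LinearEquiv.map_eq_zero_iff _).mp hk'

end IsScaledPullback

end ScaledPullback

section ResStep

variable {R : Type} [CommRing R]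

theorem isSummand_finDirectSum_const (M : ModuleCat R) :
    IsSummand R M (finDirectSum R fun _ : Fin 1 => M) :=
  ⟨ModuleCat.ofHom (LinearMap.pi fun _ => LinearMap.id),
    ModuleCat.ofHom (LinearMap.proj (φ := fun _ : Fin 1 => M) 0), rfl⟩

theorem isSummand_of_subsingleton (M N : ModuleCat R) [Subsingleton M] : IsSummand R M N :=
  ⟨0, 0, by ext m; exact Subsingleton.elim _ _⟩

theorem mem_resStep_of_subsingleton (X M : ModuleCat R) [Subsingleton M] (n : ℕ) :
    M ∈ resStep R X n := by
  cases n <;> exact ⟨0, Fin.elim0, fun i => i.elim0, isSummand_of_subsingleton _ _⟩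

theorem resStep_succ_of_ker {X M A B : ModuleCat R} {n : ℕ} (hA : A ∈ resStep R X n)
    (hB : B ∈ resStep R X n) (h : SES R M A B) : M ∈ resStep R X (n + 1) :=
  ⟨1, fun _ => M, fun _ => Or.inr ⟨A, B, hA, hB, h⟩, isSummand_finDirectSum_const M⟩

theorem resStep_subset_succ (X : ModuleCat R) (n : ℕ) :
    resStep R X n ⊆ resStep R X (n + 1) := by
  intro M hM
  refine resStep_succ_of_ker hM
    (mem_resStep_of_subsingleton X (ModuleCat.of R PUnit) n) ⟨𝟙 M, 0, ?_, ?_, ?_⟩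
  · exact fun _ _ h => h
  · exact fun y => ⟨0, Subsingleton.elim _ _⟩
  · exact fun m => ⟨fun _ => ⟨m, rfl⟩, fun _ => Subsingleton.elim _ _⟩

theorem mem_resStep_zero_self (X : ModuleCat R) : X ∈ resStep R X 0 :=
  ⟨1, fun _ => X, fun _ => Or.inl rfl, isSummand_finDirectSum_const X⟩

theorem free_prod_mem_resStep_zero (X : ModuleCat R) (n : ℕ) :
    ModuleCat.of R ((Fin n → R) × X) ∈ resStep R X 0 := by
  let f : Fin (n + 1) → ModuleCat R := fun i => Fin.cases X (fun _ => ModuleCat.of R R) i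
  refine ⟨n + 1, f, fun i => Fin.cases (Or.inl rfl) (fun _ => Or.inr rfl) i,
    ModuleCat.ofHom (LinearMap.pi fun i => Fin.cases (LinearMap.snd R (Fin n → R) X)
      (fun k => (LinearMap.proj k ∘ₗ LinearMap.fst R (Fin n → R) X :)) i),
    ModuleCat.ofHom (LinearMap.prod
      (LinearMap.pi fun k => (LinearMap.proj (R := R) (φ := fun i => f i) k.succ :))
      (LinearMap.proj (R := R) (φ := fun i => f i) 0 :)), rfl⟩

end ResStep

end

/-- Key construction: for `p ∈ NF(X)` and `x ∈ p` there are short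
exact sequences `0 → K → Rⁿ → X → 0` and `0 → K → X₁ → X → 0` with
`X₁ ∈ res² X`, `V(p) ⊆ NF(X₁) ⊆ NF(X)` and `D(x) ∩ NF(X₁) = ∅`. -/
theorem stmt7 (R : Type) [CommRing R] [IsNoetherianRing R] [IsLocalRing R]
    (X : ModuleCat R) (hX : Module.Finite R X)
    (p : PrimeSpectrum R) (hp : p ∈ nonfreeLocus R X) (x : R) (hx : x ∈ p.asIdeal) :
    ∃ (K X₁ : ModuleCat R) (n : ℕ), Module.Finite R K ∧ Module.Finite R X₁ ∧
      SES R K (ModuleCat.of R (Fin n → R)) X ∧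
      SES R K X₁ X ∧
      X₁ ∈ resStep R X 2 ∧
      (∀ q : PrimeSpectrum R, p.asIdeal ≤ q.asIdeal → q ∈ nonfreeLocus R X₁) ∧
      nonfreeLocus R X₁ ⊆ nonfreeLocus R X ∧
      (∀ q ∈ nonfreeLocus R X₁, x ∈ q.asIdeal) := by
  obtain ⟨n, π, hπ⟩ := Module.Finite.exists_fin' R X
  have h := isScaledPullback_ker x π hπ
  have hfin : ∀ q : PrimeSpectrum R, Module.Free (Localization.AtPrime q.asIdeal)
      (LocalizedModule q.asIdeal.primeCompl (Fin n → R)) := fun q =>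
    Module.free_of_isLocalizedModule q.asIdeal.primeCompl
      (LocalizedModule.mkLinearMap q.asIdeal.primeCompl (Fin n → R))
  refine ⟨ModuleCat.of R (LinearMap.ker π),
    ModuleCat.of R (LinearMap.ker (π.coprod (-x • LinearMap.id))), n,
    inferInstanceAs (Module.Finite R (LinearMap.ker π)),
    inferInstanceAs (Module.Finite R (LinearMap.ker (π.coprod (-x • LinearMap.id)))),
    ⟨ModuleCat.ofHom _, ModuleCat.ofHom _, h.injective_ι, h.surjective_π, h.exact_ι_π⟩,
    ⟨ModuleCat.ofHom _, ModuleCat.ofHom _, h.injective_i, h.surjective_s, h.exact_i_s⟩,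
    ?_, ?_, ?_, ?_⟩
  · refine resStep_subset_succ X 1 (resStep_succ_of_ker (free_prod_mem_resStep_zero X n)
      (mem_resStep_zero_self X) ⟨ModuleCat.ofHom (Submodule.subtype _),
        ModuleCat.ofHom (π.coprod (-x • LinearMap.id)), Subtype.val_injective, ?_,
        LinearMap.exact_subtype_ker_map _⟩)
    intro y
    obtain ⟨f, hf⟩ := hπ y
    exact ⟨(f, 0), by simp [hf]⟩
  · intro q hpq hfree
    have hxq : algebraMap R (Localization.AtPrime q.asIdeal) x ∈
        IsLocalRing.maximalIdeal (Localization.AtPrime q.asIdeal) :=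
      (IsLocalization.AtPrime.to_map_mem_maximal_iff _ q.asIdeal x).mpr (hpq hx)
    have hXq : q ∈ Module.freeLocus R X :=
      (h.localizedModule q.asIdeal.primeCompl).free_of_mem_maximalIdeal hxq
    have := Module.finitePresentation_of_finite R X
    exact hp (Module.isOpen_freeLocus.stableUnderGeneralization
      ((PrimeSpectrum.le_iff_specializes p q).mp hpq) hXq)
  · intro q hq hfree
    refine hq ?_
    have hXq : Module.Projective (Localization.AtPrime q.asIdeal)
        (LocalizedModule q.asIdeal.primeCompl X) := @Module.Projective.of_free _ _ _ _ _ hfree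
    have hFq := hfin q
    have := (h.localizedModule q.asIdeal.primeCompl).projective
    exact Module.free_of_flat_of_isLocalRing
  · intro q hq
    by_contra hxq
    refine hq ?_
    have hu : IsUnit (algebraMap R (Localization.AtPrime q.asIdeal) x) :=
      IsLocalization.map_units _ (⟨x, hxq⟩ : q.asIdeal.primeCompl)
    exact .of_equiv (LinearEquiv.ofBijective _
      ((h.localizedModule q.asIdeal.primeCompl).bijective_j hu)).symm
end

section
/- Let R be a commutative noetherian ring, X a finitely generated R-module, and W a Zariski-closed subset of Spec R contained in NF(X). Then there exists a finitely generated R-module Y in the resolving closure res X such that W = NF(Y). -/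
open CategoryTheory

namespace Module

variable {R : Type*} [CommRing R]

/-- Multiplication by `s` on `M` factors through a finitely generated free module. -/
def SMulFactorsThroughFree (M : Type*) [AddCommGroup M] [Module R M] (s : R) : Prop :=
  ∃ (n : ℕ) (f : M →ₗ[R] (Fin n → R)) (g : (Fin n → R) →ₗ[R] M), g ∘ₗ f = s • LinearMap.id

variable {M : Type*} [AddCommGroup M] [Module R M] {s : R}

theorem SMulFactorsThroughFree.of_comp {F : Type*} [AddCommGroup F] [Module R F]
    [Module.Free R F] [Module.Finite R F] (f : M →ₗ[R] F) (g : F →ₗ[R] M)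
    (h : ∀ m, g (f m) = s • m) : SMulFactorsThroughFree M s := by
  rcases subsingleton_or_nontrivial R with hR | hR
  · have := Module.subsingleton R M
    exact ⟨0, 0, 0, Subsingleton.elim _ _⟩
  · let e := (Module.finBasis R F).equivFun
    exact ⟨_, e.toLinearMap ∘ₗ f, g ∘ₗ e.symm.toLinearMap, by ext m; simp [h]⟩

/-- A factorization through a free module can be moved to any given surjection. -/
theorem SMulFactorsThroughFree.exists_section (h : SMulFactorsThroughFree M s)
    {F : Type*} [AddCommGroup F] [Module R F] (π : F →ₗ[R] M) (hπ : Function.Surjective π) :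
    ∃ σ : M →ₗ[R] F, ∀ m, π (σ m) = s • m := by
  obtain ⟨n, f, g, hfg⟩ := h
  obtain ⟨g', hg'⟩ := Module.projective_lifting_property π g hπ
  refine ⟨g' ∘ₗ f, fun m ↦ ?_⟩
  have h₁ := LinearMap.congr_fun hg' (f m)
  have h₂ := LinearMap.congr_fun hfg m
  simp only [LinearMap.comp_apply, LinearMap.smul_apply, LinearMap.id_apply] at h₁ h₂ ⊢
  rw [h₁, h₂]

theorem free_localization_iff_exists_smulFactorsThroughFree [IsNoetherianRing R]
    [Module.Finite R M] (p : PrimeSpectrum R) :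
    Module.Free (Localization.AtPrime p.asIdeal) (LocalizedModule p.asIdeal.primeCompl M) ↔
      ∃ s ∉ p.asIdeal, SMulFactorsThroughFree M s := by
  set S := p.asIdeal.primeCompl
  constructor
  · intro hfree
    obtain ⟨n, π, hπ⟩ := Module.Finite.exists_fin' R M
    obtain ⟨σ, hσ⟩ := Module.projective_lifting_property (LocalizedModule.map S π) LinearMap.id
      (LocalizedModule.map_surjective S π hπ)
    have : Module.FinitePresentation R M := Module.finitePresentation_of_finite R M
    obtain ⟨h, t, ht⟩ := Module.FinitePresentation.exists_lift_of_isLocalizedModule S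
      (LocalizedModule.mkLinearMap S (Fin n → R))
      (σ.restrictScalars R ∘ₗ LocalizedModule.mkLinearMap S M)
    obtain ⟨u, hu⟩ := Module.Finite.exists_smul_of_comp_eq_of_isLocalizedModule S
      (LocalizedModule.mkLinearMap S M) (π ∘ₗ h) (t.1 • LinearMap.id) (by
        ext m
        have h₁ := congrArg (LocalizedModule.map S π) (LinearMap.congr_fun ht m)
        have h₂ := LinearMap.congr_fun hσ (LocalizedModule.mkLinearMap S M m)
        simp only [LinearMap.comp_apply, LinearMap.smul_apply, Submonoid.smul_def,
          LinearMap.restrictScalars_apply, LinearMap.map_smul_of_tower, LinearMap.id_apply] at h₁ h₂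
        rw [h₂] at h₁
        simpa using h₁)
    refine ⟨u.1 * t.1, (u * t).2, .of_comp h (u.1 • π) fun m ↦ ?_⟩
    simpa [mul_smul, Submonoid.smul_def] using LinearMap.congr_fun hu m
  · rintro ⟨s, hs, n, f, g, hfg⟩
    let t : S := ⟨s, hs⟩
    have : Module.Projective (Localization S) (LocalizedModule S M) := by
      refine .of_split (LocalizedModule.map S f)
        (Localization.mk 1 t • LocalizedModule.map S g) ?_
      ext m
      induction m using LocalizedModule.induction_on with | _ m u
      have h : g (f m) = t • m := LinearMap.congr_fun hfg m
      have hmap : LocalizedModule.map S g (LocalizedModule.map S f (LocalizedModule.mk m u)) =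
          LocalizedModule.mk (t • m) u := by
        rw [← h]
        exact (congrArg _ (IsLocalizedModule.map_LocalizedModules S f m u)).trans
          (IsLocalizedModule.map_LocalizedModules S g (f m) u)
      rw [LinearMap.comp_apply, LinearMap.smul_apply, hmap, LocalizedModule.mk_smul_mk, one_smul,
        LocalizedModule.mk_cancel_common_left, LinearMap.id_apply]
    exact Module.free_of_flat_of_isLocalRing

/-- If `b` is an endomorphism of a finite module and `x ∈ p`, `s ∉ p`, then `s + x b` divides
multiplication by some scalar outside `p`. -/
theorem exists_comp_add_smul_eq_smul [Module.Finite R M] (b : M →ₗ[R] M) {p : Ideal R}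
    [p.IsPrime] {x : R} (hx : x ∈ p) (hs : s ∉ p) :
    ∃ t ∉ p, ∃ d : M →ₗ[R] M, ∀ m, d (s • m + x • b m) = t • m := by
  obtain ⟨P, hP, -, hcoeff, hP0⟩ :=
    LinearMap.exists_monic_and_natDegree_eq_and_coeff_mem_pow_and_aeval_eq_zero R (x • b) p (by
      rintro _ ⟨m, rfl⟩
      exact Submodule.smul_mem_smul hx trivial)
  obtain ⟨Q, hQ⟩ := Polynomial.X_sub_C_dvd_sub_C_eval (p := P) (a := -s)
  refine ⟨-P.eval (-s), ?_, Polynomial.aeval (x • b) Q, fun m ↦ ?_⟩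
  · have hs' : -P.eval (-s) ∈ p ↔ (Ideal.Quotient.mk p) (P.eval (-s)) = 0 := by
      rw [neg_mem_iff, Ideal.Quotient.eq_zero_iff_mem]
    have hmap : P.map (Ideal.Quotient.mk p) = Polynomial.X ^ P.natDegree := by
      ext k
      rw [Polynomial.coeff_map, Polynomial.coeff_X_pow]
      split_ifs with hk
      · rw [hk, hP.coeff_natDegree, map_one]
      · rw [Ideal.Quotient.eq_zero_iff_mem]
        rcases lt_or_gt_of_ne hk with hk | hk
        · exact Ideal.pow_le_self (by omega) (hcoeff k)
        · simp [Polynomial.coeff_eq_zero_of_natDegree_lt hk]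
    rw [hs', ← Polynomial.eval_map_apply, hmap, Polynomial.eval_pow, Polynomial.eval_X,
      ← map_pow, Ideal.Quotient.eq_zero_iff_mem]
    exact fun h ↦ hs (neg_mem_iff.1 (‹p.IsPrime›.mem_of_pow_mem _ h))
  · have h := congrArg (fun A ↦ Polynomial.aeval (x • b) A m) hQ
    simp [mul_comm _ Q, hP0] at h
    rw [neg_smul, h, map_add, map_smul, map_smul, add_comm]

end Module

open Module

section Pushout

variable {R : Type*} [CommRing R] {F X : Type*} [AddCommGroup F] [Module R F]
  [AddCommGroup X] [Module R X]

/-- The map `k ↦ (k, -x k)` from the kernel of `π` to `F × ker π`. -/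
def kerSMulGraph (π : F →ₗ[R] X) (x : R) : LinearMap.ker π →ₗ[R] F × LinearMap.ker π :=
  (LinearMap.ker π).subtype.prod (-(x • LinearMap.id))

/-- The pushout of `ker π → F` along multiplication by `x` on `ker π`. -/
abbrev KerPushout (π : F →ₗ[R] X) (x : R) : Type _ :=
  (F × LinearMap.ker π) ⧸ LinearMap.range (kerSMulGraph π x)

namespace KerPushout

variable (π : F →ₗ[R] X) (x : R)

/-- The inclusion of the kernel into the pushout. -/
def inr : LinearMap.ker π →ₗ[R] KerPushout π x :=
  (LinearMap.range (kerSMulGraph π x)).mkQ ∘ₗ LinearMap.inr R F (LinearMap.ker π)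

/-- The projection from the pushout onto the target of `π`. -/
def proj : KerPushout π x →ₗ[R] X :=
  (LinearMap.range (kerSMulGraph π x)).liftQ (π ∘ₗ LinearMap.fst R F (LinearMap.ker π)) (by
    rintro _ ⟨k, rfl⟩
    simp [kerSMulGraph])

theorem mk_eq_mk_iff {f f' : F} {k k' : LinearMap.ker π} :
    ((LinearMap.range (kerSMulGraph π x)).mkQ (f, k) =
      (LinearMap.range (kerSMulGraph π x)).mkQ (f', k')) ↔
      ∃ l : LinearMap.ker π, (l : F) = f - f' ∧ -(x • l) = k - k' := by
  rw [Submodule.mkQ_apply, Submodule.mkQ_apply, Submodule.Quotient.eq, LinearMap.mem_range]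
  exact exists_congr fun l ↦ Prod.ext_iff

theorem inr_injective : Function.Injective (inr π x) := by
  intro k k' h
  obtain ⟨l, h₁, h₂⟩ := (mk_eq_mk_iff π x).1 h
  obtain rfl : l = 0 := Subtype.ext (by simpa using h₁)
  exact (sub_eq_zero.1 (by simpa using h₂.symm))

theorem proj_surjective (hπ : Function.Surjective π) : Function.Surjective (proj π x) := by
  intro m
  obtain ⟨f, rfl⟩ := hπ m
  exact ⟨(LinearMap.range (kerSMulGraph π x)).mkQ (f, 0), by simp [proj]⟩

theorem exact_inr_proj : Function.Exact (inr π x) (proj π x) := by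
  intro y
  obtain ⟨⟨f, k⟩, rfl⟩ := Submodule.mkQ_surjective _ y
  constructor
  · intro h
    have hf : π f = 0 := by simpa [proj] using h
    refine ⟨k + x • ⟨f, hf⟩, (mk_eq_mk_iff π x).2 ⟨-⟨f, hf⟩, by simp, by simp⟩⟩
  · rintro ⟨l, hl⟩
    rw [← hl]
    simp [inr, proj]

variable [Module.Free R F] [Module.Finite R F]

theorem smulFactorsThroughFree_self : SMulFactorsThroughFree (KerPushout π x) x := by
  refine .of_comp
    ((LinearMap.range (kerSMulGraph π x)).liftQ
      ((x • LinearMap.id).coprod (LinearMap.ker π).subtype) ?_)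
    ((LinearMap.range (kerSMulGraph π x)).mkQ ∘ₗ LinearMap.inl R F (LinearMap.ker π))
    fun y ↦ ?_
  · rintro _ ⟨k, rfl⟩
    simp [kerSMulGraph]
  · obtain ⟨⟨f, k⟩, rfl⟩ := Submodule.mkQ_surjective _ y
    rw [← map_smul]
    exact (mk_eq_mk_iff π x).2 ⟨k, by simp, by simp⟩

theorem smulFactorsThroughFree_of_target (hπ : Function.Surjective π) {s : R}
    (h : SMulFactorsThroughFree X s) : SMulFactorsThroughFree (KerPushout π x) s := by
  obtain ⟨σ, hσ⟩ := h.exists_section π hπ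
  let τ : F →ₗ[R] LinearMap.ker π :=
    LinearMap.codRestrict _ (s • LinearMap.id - σ ∘ₗ π) (by simp [hσ])
  refine .of_comp (F := F × F)
    ((LinearMap.range (kerSMulGraph π x)).liftQ
      ((σ ∘ₗ π ∘ₗ LinearMap.fst R F (LinearMap.ker π)).prod
        ((x • LinearMap.id).coprod (LinearMap.ker π).subtype)) ?_)
    ((LinearMap.range (kerSMulGraph π x)).mkQ ∘ₗ LinearMap.id.prodMap τ) fun y ↦ ?_
  · rintro _ ⟨k, rfl⟩
    simp [kerSMulGraph]
  · obtain ⟨⟨f, k⟩, rfl⟩ := Submodule.mkQ_surjective _ y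
    rw [← map_smul]
    refine (mk_eq_mk_iff π x).2 ⟨-τ f, by simp [τ], ?_⟩
    ext
    simp [τ, smul_sub, smul_comm s x]
    abel

theorem exists_smulFactorsThroughFree_target [IsNoetherianRing R]
    (hπ : Function.Surjective π) {p : Ideal R} [p.IsPrime] (hx : x ∈ p) {s : R} (hs : s ∉ p)
    (h : SMulFactorsThroughFree (KerPushout π x) s) :
    ∃ t ∉ p, SMulFactorsThroughFree X t := by
  obtain ⟨ρ, hρ⟩ := h.exists_section _
    (Submodule.mkQ_surjective (LinearMap.range (kerSMulGraph π x)))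
  have hinj : Function.Injective (kerSMulGraph π x) := fun k k' hk ↦
    Subtype.ext (congrArg Prod.fst hk)
  let r : F × LinearMap.ker π →ₗ[R] LinearMap.ker π :=
    (LinearEquiv.ofInjective _ hinj).symm.toLinearMap ∘ₗ LinearMap.codRestrict _
      (s • LinearMap.id - ρ ∘ₗ (LinearMap.range (kerSMulGraph π x)).mkQ) (fun c ↦ by
        rw [← Submodule.Quotient.mk_eq_zero, ← Submodule.mkQ_apply]
        simp only [LinearMap.sub_apply, LinearMap.smul_apply, LinearMap.id_apply, map_sub,
          LinearMap.comp_apply, hρ, map_smul, sub_self])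
  have hr : ∀ k, r (kerSMulGraph π x k) = s • k := by
    intro k
    apply hinj
    have h0 : (LinearMap.range (kerSMulGraph π x)).mkQ (kerSMulGraph π x k) = 0 := by simp
    refine (congrArg Subtype.val
      ((LinearEquiv.ofInjective _ hinj).apply_symm_apply _)).trans ?_
    simp only [LinearMap.codRestrict_apply, LinearMap.sub_apply, LinearMap.smul_apply,
      LinearMap.id_apply, LinearMap.comp_apply, h0, map_zero, sub_zero, map_smul]
  have hr' : ∀ k : LinearMap.ker π, r (k, 0) = s • k + x • r (0, k) := by
    intro k
    have : ((k : F), (0 : LinearMap.ker π)) = kerSMulGraph π x k + x • ((0 : F), k) := by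
      simp [kerSMulGraph]
    rw [this, map_add, hr, map_smul]
  obtain ⟨t, ht, d, hd⟩ := exists_comp_add_smul_eq_smul
    (r ∘ₗ LinearMap.inr R F (LinearMap.ker π)) hx hs
  let e : F →ₗ[R] F := t • LinearMap.id -
    (LinearMap.ker π).subtype ∘ₗ d ∘ₗ r ∘ₗ LinearMap.inl R F (LinearMap.ker π)
  have he : LinearMap.ker π ≤ LinearMap.ker e := by
    intro k hk
    have h₁ := hd ⟨k, hk⟩
    have h₂ := hr' ⟨k, hk⟩
    simp only [LinearMap.comp_apply, LinearMap.inr_apply] at h₁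
    rw [← h₂] at h₁
    simp [e, h₁]
  refine ⟨t, ht, .of_comp ((LinearMap.ker π).liftQ e he ∘ₗ
    (π.quotKerEquivOfSurjective hπ).symm.toLinearMap) π fun m ↦ ?_⟩
  obtain ⟨f, rfl⟩ := hπ m
  have : (π.quotKerEquivOfSurjective hπ).symm (π f) = (LinearMap.ker π).mkQ f := by
    rw [LinearEquiv.symm_apply_eq]; rfl
  simp [this, e]

end KerPushout

end Pushout

theorem mem_nonfreeLocus_iff {R : Type} [CommRing R] [IsNoetherianRing R] (M : ModuleCat R)
    [Module.Finite R M] (p : PrimeSpectrum R) :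
    p ∈ nonfreeLocus R M ↔ ¬ ∃ s ∉ p.asIdeal, SMulFactorsThroughFree M s :=
  not_congr (free_localization_iff_exists_smulFactorsThroughFree p)

/-- Every resolving class containing `M` contains a module whose nonfree locus is the part
of `NF(M)` where `x` vanishes. -/
theorem exists_nonfreeLocus_eq_inter_zeroLocus.{u} {R : Type} [CommRing R] [IsNoetherianRing R]
    (M : ModuleCat.{u} R) [Module.Finite R M] (x : R) :
    ∃ Y : ModuleCat.{u} R, Module.Finite R Y ∧ (∀ 𝒴, IsResolving R 𝒴 → M ∈ 𝒴 → Y ∈ 𝒴) ∧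
      nonfreeLocus R Y = nonfreeLocus R M ∩ PrimeSpectrum.zeroLocus {x} := by
  obtain ⟨n, π₀, hπ₀⟩ := Module.Finite.exists_fin' R M
  let π : ULift.{u} (Fin n → R) →ₗ[R] M := π₀ ∘ₗ ULift.moduleEquiv.toLinearMap
  have hπ : Function.Surjective π := hπ₀.comp ULift.moduleEquiv.surjective
  refine ⟨ModuleCat.of R (KerPushout π x), inferInstance, fun 𝒴 h𝒴 hM ↦ ?_, ?_⟩
  · have hker : ModuleCat.of R (LinearMap.ker π) ∈ 𝒴 :=
      h𝒴.ker_epi_closed _ (ModuleCat.of R (ULift.{u} (Fin n → R))) M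
        ⟨ModuleCat.ofHom (LinearMap.ker π).subtype, ModuleCat.ofHom π,
          Subtype.val_injective, hπ, LinearMap.exact_subtype_ker_map π⟩
        (h𝒴.proj_mem _ inferInstance inferInstance) hM
    exact h𝒴.ext_closed _ _ M
      ⟨ModuleCat.ofHom (KerPushout.inr π x), ModuleCat.ofHom (KerPushout.proj π x),
        KerPushout.inr_injective π x, KerPushout.proj_surjective π x hπ,
        KerPushout.exact_inr_proj π x⟩ hker hM
  · ext p
    have : Module.Finite R (ModuleCat.of R (KerPushout π x)) := inferInstance
    rw [Set.mem_inter_iff, mem_nonfreeLocus_iff, mem_nonfreeLocus_iff,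
      PrimeSpectrum.mem_zeroLocus, Set.singleton_subset_iff, SetLike.mem_coe]
    constructor
    · refine fun h ↦ ⟨fun ⟨s, hs, hM⟩ ↦ h ⟨s, hs, ?_⟩, by_contra fun hx ↦ h ⟨x, hx, ?_⟩⟩
      · exact KerPushout.smulFactorsThroughFree_of_target π x hπ hM
      · exact KerPushout.smulFactorsThroughFree_self π x
    · rintro ⟨hM, hx⟩ ⟨s, hs, h⟩
      exact hM (KerPushout.exists_smulFactorsThroughFree_target π x hπ hx hs h)

/-- Every closed subset of `Spec R` contained in `NF(X)` is the
nonfree locus of some module in the resolving closure of `X`. -/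
theorem stmt8 (R : Type) [CommRing R] [IsNoetherianRing R]
    (X : ModuleCat R) (hX : Module.Finite R X)
    (W : Set (PrimeSpectrum R)) (hWc : IsClosed W) (hW : W ⊆ nonfreeLocus R X) :
    ∃ Y : ModuleCat R, Module.Finite R Y ∧ Y ∈ resClosure R {X} ∧
      W = nonfreeLocus R Y := by
  obtain ⟨I, rfl⟩ := (PrimeSpectrum.isClosed_iff_zeroLocus_ideal W).1 hWc
  obtain ⟨S, rfl⟩ := IsNoetherian.noetherian I
  have key : ∀ S : Finset R, ∃ Y : ModuleCat R, Module.Finite R Y ∧ Y ∈ resClosure R {X} ∧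
      nonfreeLocus R Y = nonfreeLocus R X ∩ PrimeSpectrum.zeroLocus (S : Set R) := by
    classical
    intro S
    induction S using Finset.induction_on with
    | empty => exact ⟨X, hX, fun 𝒴 h𝒴 ↦ h𝒴.2 rfl, by simp⟩
    | insert x S _ ih =>
      obtain ⟨Y, hY, hYX, hYS⟩ := ih
      obtain ⟨Z, hZ, hZY, hZx⟩ := exists_nonfreeLocus_eq_inter_zeroLocus Y x
      refine ⟨Z, hZ, fun 𝒴 h𝒴 ↦ hZY 𝒴 h𝒴.1 (hYX 𝒴 h𝒴), ?_⟩
      rw [hZx, hYS, Set.inter_assoc, ← PrimeSpectrum.zeroLocus_union, Finset.coe_insert,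
        Set.union_singleton]
  obtain ⟨Y, hY, hYX, hYS⟩ := key S
  refine ⟨Y, hY, hYX, ?_⟩
  rw [hYS]
  exact (Set.inter_eq_right.2 (by simpa using hW)).symm ▸ PrimeSpectrum.zeroLocus_span _
end

section
/- Let R be a commutative noetherian ring and X a finitely generated R-module that is not projective. Then there exist finitely many finitely generated R-modules Y₁, …, Y_n in the resolving closure res X such that NF(X) = NF(Y₁) ∪ ⋯ ∪ NF(Y_n) and each NF(Y_i) is an irreducible closed subset of Spec R. -/
open CategoryTheory

section

variable {R : Type*} [CommRing R] {M F : Type*} [AddCommGroup M] [Module R M]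
  [AddCommGroup F] [Module R F]

/-- If `s • id` factors through a projective module and `s ∉ p`, then `M` is free at `p`. -/
theorem mem_freeLocus_of_comp_eq_smul [Module.Finite R M] [Module.Projective R F]
    {p : PrimeSpectrum R} {s : R} (hs : s ∉ p.asIdeal) (a : M →ₗ[R] F) (b : F →ₗ[R] M)
    (h : ∀ m, b (a m) = s • m) : p ∈ Module.freeLocus R M := by
  rw [Module.mem_freeLocus]
  set S := p.asIdeal.primeCompl
  let u : (Localization S)ˣ :=
    IsUnit.unit (IsLocalization.map_units (Localization S) (⟨s, hs⟩ : S))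
  have hu : (u : Localization S) = algebraMap R (Localization S) s := IsUnit.unit_spec _
  have : Module.Projective (Localization S) (LocalizedModule S M) := by
    have : Module.Projective (Localization S) (LocalizedModule S F) :=
      Module.projective_of_isLocalizedModule S (LocalizedModule.mkLinearMap S F)
    refine Module.Projective.of_split (M := LocalizedModule S F)
      (((u⁻¹ : (Localization S)ˣ) : Localization S) • LocalizedModule.map S a)
      (LocalizedModule.map S b) ?_
    ext m
    induction m using LocalizedModule.induction_on with
    | h m t =>
      have : LocalizedModule.mk (s • m) t = (u : Localization S) • LocalizedModule.mk m t := by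
        rw [hu, algebraMap_smul, LocalizedModule.smul'_mk]
      simp [LocalizedModule.map_mk, h, this, smul_smul]
  have : Module.Finite (Localization S) (LocalizedModule S M) := inferInstance
  exact Module.free_of_flat_of_isLocalRing

/-- If `M` is free at `p`, then every surjection onto `M` splits up to some `s ∉ p`. -/
theorem exists_comp_eq_smul_of_mem_freeLocus [Module.FinitePresentation R M]
    {p : PrimeSpectrum R} (hp : p ∈ Module.freeLocus R M) {π : F →ₗ[R] M}
    (hπ : Function.Surjective π) :
    ∃ s ∉ p.asIdeal, ∃ h : M →ₗ[R] F, ∀ m, π (h m) = s • m := by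
  rw [Module.mem_freeLocus] at hp
  set S := p.asIdeal.primeCompl
  obtain ⟨σ, hσ⟩ := Module.projective_lifting_property (LocalizedModule.map S π) LinearMap.id
    (LocalizedModule.map_surjective S π hπ)
  obtain ⟨h, s, hs⟩ := Module.FinitePresentation.exists_lift_of_isLocalizedModule S
    (LocalizedModule.mkLinearMap S F) ((σ.restrictScalars R) ∘ₗ LocalizedModule.mkLinearMap S M)
  obtain ⟨t, ht⟩ := Module.Finite.exists_smul_of_comp_eq_of_isLocalizedModule S
    (LocalizedModule.mkLinearMap S M) (π ∘ₗ h) (s • LinearMap.id) <| by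
      ext m
      have h1 := congrArg (LocalizedModule.map S π) (LinearMap.congr_fun hs m)
      have h2 := LinearMap.congr_fun hσ (LocalizedModule.mkLinearMap S M m)
      simp only [LinearMap.comp_apply, LinearMap.smul_apply, LinearMap.restrictScalars_apply,
        LinearMap.id_apply, LocalizedModule.mkLinearMap_apply, LocalizedModule.map_mk] at h1 h2 ⊢
      rw [h1, Submonoid.smul_def, LinearMap.map_smul_of_tower, h2, Submonoid.smul_def,
        LocalizedModule.smul'_mk]
  refine ⟨t * s, (t * s).2, (t : R) • h, fun m ↦ ?_⟩
  have := LinearMap.congr_fun ht m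
  simpa [Submonoid.smul_def, mul_smul] using this

/-- An endomorphism `s + x β` with `s ∉ p` and `x ∈ p` is invertible up to some `t ∉ p`. -/
theorem exists_comp_smul_add_smul_eq_smul [Module.Finite R M] (p : Ideal R) [p.IsPrime]
    {s x : R} (hs : s ∉ p) (hx : x ∈ p) (β : Module.End R M) :
    ∃ t ∉ p, ∃ γ : Module.End R M, ∀ m, γ (s • m + x • β m) = t • m := by
  obtain ⟨P, hP, -, hc, h0⟩ :=
    LinearMap.exists_monic_and_natDegree_eq_and_coeff_mem_pow_and_aeval_eq_zero R (x • β) p (by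
      rintro _ ⟨m, rfl⟩
      exact Submodule.smul_mem_smul hx trivial)
  set Q := P.comp (Polynomial.X - Polynomial.C s) with hQ
  have hQ0 : Polynomial.aeval (s • (1 : Module.End R M) + x • β) Q = 0 := by
    rw [hQ, Polynomial.aeval_comp]
    convert h0 using 2
    simp [Algebra.algebraMap_eq_smul_one]
  refine ⟨- Q.coeff 0, fun hmem ↦ hs ?_,
    Polynomial.aeval (s • (1 : Module.End R M) + x • β) Q.divX,
    fun m ↦ ?_⟩
  · have h1 : Q.coeff 0 = P.eval (-s) := by
      simp [hQ, Polynomial.coeff_zero_eq_eval_zero, Polynomial.eval_comp]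
    have h2 : P.eval (-s) - (-s) ^ P.natDegree ∈ p := by
      rw [Polynomial.eval_eq_sum_range, Finset.sum_range_succ, hP.coeff_natDegree, one_mul,
        add_sub_cancel_right]
      refine Ideal.sum_mem _ fun i hi ↦ Ideal.mul_mem_right _ _ ?_
      exact Ideal.pow_le_self (Nat.sub_ne_zero_of_lt (Finset.mem_range.1 hi)) (hc i)
    rw [← h1] at h2
    have := sub_mem (neg_mem_iff.1 hmem) h2
    rw [sub_sub_cancel] at this
    exact neg_mem_iff.1 (Ideal.IsPrime.mem_of_pow_mem ‹_› _ this)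
  · rw [← Polynomial.divX_mul_X_add Q] at hQ0
    have := LinearMap.congr_fun hQ0 m
    simp only [map_add, map_mul, Polynomial.aeval_X, Polynomial.aeval_C, LinearMap.add_apply,
      Module.End.mul_apply, LinearMap.smul_apply, Module.End.one_apply,
      Module.algebraMap_end_apply, LinearMap.zero_apply] at this
    rw [neg_smul]
    simpa using eq_neg_of_add_eq_zero_left this

/-- The inclusion `w ↦ (w, -x w)` of the kernel `Ω` of `π : F → M` into `F × Ω`. -/
def syzygyGraph (π : F →ₗ[R] M) (x : R) : LinearMap.ker π →ₗ[R] F × LinearMap.ker π :=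
  (LinearMap.ker π).subtype.prod (-(x • LinearMap.id))

@[simp]
theorem syzygyGraph_apply (π : F →ₗ[R] M) (x : R) (w : LinearMap.ker π) :
    syzygyGraph π x w = ((w : F), -(x • w)) := rfl

/-- The pushout of `Ω → F` along multiplication by `x` on `Ω`, where `Ω` is the kernel of
`π : F → M`; it represents `x` times the class of `0 → Ω → F → M → 0` in `Ext¹(M, Ω)`. -/
abbrev SyzygyPushout (π : F →ₗ[R] M) (x : R) :=
  (F × LinearMap.ker π) ⧸ LinearMap.range (syzygyGraph π x)

namespace SyzygyPushout

variable (π : F →ₗ[R] M) (x : R)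

/-- The inclusion of the syzygy into the pushout. -/
def inr : LinearMap.ker π →ₗ[R] SyzygyPushout π x :=
  (LinearMap.range (syzygyGraph π x)).mkQ ∘ₗ LinearMap.inr R F (LinearMap.ker π)

/-- The canonical map from `F` into the pushout. -/
def inl : F →ₗ[R] SyzygyPushout π x :=
  (LinearMap.range (syzygyGraph π x)).mkQ ∘ₗ LinearMap.inl R F (LinearMap.ker π)

/-- The universal property of the pushout. -/
def desc {N : Type*} [AddCommGroup N] [Module R N] (f : F →ₗ[R] N) (g : LinearMap.ker π →ₗ[R] N)
    (h : ∀ w : LinearMap.ker π, f w = x • g w) : SyzygyPushout π x →ₗ[R] N :=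
  (LinearMap.range (syzygyGraph π x)).liftQ (f.coprod g) <| by
    rintro _ ⟨w, rfl⟩
    simp [h]

variable {π x}

theorem exists_rep (y : SyzygyPushout π x) : ∃ f w, y = inl π x f + inr π x w := by
  obtain ⟨⟨f, w⟩, rfl⟩ := Submodule.Quotient.mk_surjective _ y
  refine ⟨f, w, ?_⟩
  simp [inl, inr, ← Submodule.Quotient.mk_add]

theorem inl_coe (w : LinearMap.ker π) : inl π x w = x • inr π x w := by
  rw [← map_smul]
  refine (Submodule.Quotient.eq _).2 ⟨w, ?_⟩
  simp

@[simp]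
theorem desc_inl {N : Type*} [AddCommGroup N] [Module R N] (f : F →ₗ[R] N)
    (g : LinearMap.ker π →ₗ[R] N) (h : ∀ w : LinearMap.ker π, f w = x • g w) (v : F) :
    desc π x f g h (inl π x v) = f v := by
  simp [desc, inl]

@[simp]
theorem desc_inr {N : Type*} [AddCommGroup N] [Module R N] (f : F →ₗ[R] N)
    (g : LinearMap.ker π →ₗ[R] N) (h : ∀ w : LinearMap.ker π, f w = x • g w)
    (w : LinearMap.ker π) : desc π x f g h (inr π x w) = g w := by
  simp [desc, inr]

variable (π x) in
/-- The projection of the pushout onto `M`. -/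
def toBase : SyzygyPushout π x →ₗ[R] M :=
  desc π x π 0 fun w ↦ by simp

theorem toBase_surjective (hπ : Function.Surjective π) : Function.Surjective (toBase π x) := by
  intro m
  obtain ⟨f, rfl⟩ := hπ m
  exact ⟨inl π x f, by simp [toBase]⟩

theorem inr_injective : Function.Injective (inr π x) := by
  rw [injective_iff_map_eq_zero]
  intro w hw
  obtain ⟨v, hv⟩ := (Submodule.Quotient.mk_eq_zero _).1 hw
  simp only [syzygyGraph_apply, LinearMap.inr_apply, Prod.mk.injEq, ZeroMemClass.coe_eq_zero] at hv
  rw [← hv.2, hv.1, smul_zero, neg_zero]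

theorem exact_inr_toBase : Function.Exact (inr π x) (toBase π x) := by
  intro y
  constructor
  · obtain ⟨f, w, rfl⟩ := exists_rep y
    intro h
    have hf : f ∈ LinearMap.ker π := by simpa [toBase] using h
    refine ⟨x • ⟨f, hf⟩ + w, ?_⟩
    rw [map_add, map_smul, ← inl_coe]
  · rintro ⟨w, rfl⟩
    simp [toBase]

variable [Module.Finite R F] [IsNoetherianRing R]

theorem mem_freeLocus_of_notMem [Module.Projective R F] {p : PrimeSpectrum R}
    (hx : x ∉ p.asIdeal) : p ∈ Module.freeLocus R (SyzygyPushout π x) := by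
  have h (w : LinearMap.ker π) :
      (x • LinearMap.id : F →ₗ[R] F) w = x • (LinearMap.ker π).subtype w := rfl
  refine mem_freeLocus_of_comp_eq_smul hx (desc π x _ _ h) (inl π x) fun y ↦ ?_
  obtain ⟨f, w, rfl⟩ := exists_rep y
  simp [inl_coe]

theorem freeLocus_base_subset [Module.Finite R M] [Module.Projective R F]
    (hπ : Function.Surjective π) :
    Module.freeLocus R M ⊆ Module.freeLocus R (SyzygyPushout π x) := by
  intro p hp
  have := Module.finitePresentation_of_finite R M
  obtain ⟨s, hs, h, hh⟩ := exists_comp_eq_smul_of_mem_freeLocus hp hπ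
  let r : F →ₗ[R] LinearMap.ker π := (s • LinearMap.id - h ∘ₗ π).codRestrict _ fun f ↦ by simp [hh]
  have hr (f : F) : ((r f : LinearMap.ker π) : F) = s • f - h (π f) := rfl
  have hrw (w : LinearMap.ker π) : r w = s • w := by ext; simp [hr]
  refine mem_freeLocus_of_comp_eq_smul (s := s * s) (F := F × F)
    (fun hmem ↦ hs ((p.2.mem_or_mem hmem).elim id id))
    (LinearMap.prod (s • h ∘ₗ toBase π x)
      ((LinearMap.ker π).subtype ∘ₗ desc π x (x • r) (s • LinearMap.id) fun w ↦ by simp [hrw]))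
    (LinearMap.coprod (inl π x) (inr π x ∘ₗ r)) fun y ↦ ?_
  obtain ⟨f, w, rfl⟩ := exists_rep y
  simp only [toBase, LinearMap.coprod_apply, LinearMap.prod_apply, Function.prod, LinearMap.smul_apply,
    LinearMap.comp_apply, map_add, desc_inl, desc_inr, Submodule.subtype_apply, hrw,
    LinearMap.zero_apply, LinearMap.id_apply, map_smul]
  rw [smul_comm x, ← inl_coe, hr]
  simp only [map_sub, map_smul, map_zero, smul_zero, smul_sub, smul_add, mul_smul]
  abel

theorem mem_freeLocus_base [Module.Finite R M] {p : PrimeSpectrum R} [Module.Projective R F]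
    (hπ : Function.Surjective π) (hx : x ∈ p.asIdeal)
    (hp : p ∈ Module.freeLocus R (SyzygyPushout π x)) : p ∈ Module.freeLocus R M := by
  have := Module.finitePresentation_of_finite R (SyzygyPushout π x)
  obtain ⟨s, hs, σ, hσ⟩ := exists_comp_eq_smul_of_mem_freeLocus hp
    (LinearMap.range (syzygyGraph π x)).mkQ_surjective
  have hj : Function.Injective (syzygyGraph π x) := fun v w hvw ↦
    Subtype.ext (congrArg Prod.fst hvw)
  let e := LinearEquiv.ofInjective _ hj
  let κ : F × LinearMap.ker π →ₗ[R] LinearMap.ker π := e.symm ∘ₗ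
    (s • LinearMap.id - σ ∘ₗ (LinearMap.range (syzygyGraph π x)).mkQ).codRestrict _ fun z ↦ by
      refine (Submodule.Quotient.mk_eq_zero (LinearMap.range (syzygyGraph π x))).1 ?_
      rw [← Submodule.mkQ_apply]
      simp only [LinearMap.sub_apply, LinearMap.smul_apply, LinearMap.id_apply,
        LinearMap.comp_apply, map_sub, hσ, map_smul, sub_self]
  have hκ (w : LinearMap.ker π) : κ (syzygyGraph π x w) = s • w := by
    apply e.injective
    have h0 : (LinearMap.range (syzygyGraph π x)).mkQ (syzygyGraph π x w) = 0 :=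
      (Submodule.Quotient.mk_eq_zero _).2 ⟨w, rfl⟩
    simp only [κ, LinearMap.comp_apply, LinearEquiv.coe_coe, LinearEquiv.apply_symm_apply]
    ext1
    simp only [LinearMap.codRestrict_apply, LinearMap.sub_apply, LinearMap.smul_apply,
      LinearMap.id_apply, LinearMap.comp_apply, h0, map_zero, sub_zero, e, map_smul,
      Submodule.coe_smul, LinearEquiv.ofInjective_apply]
  obtain ⟨t, ht, γ, hγ⟩ := exists_comp_smul_add_smul_eq_smul p.asIdeal hs hx
    (κ ∘ₗ LinearMap.inr R F (LinearMap.ker π))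
  let r : F →ₗ[R] LinearMap.ker π := γ ∘ₗ κ ∘ₗ LinearMap.inl R F (LinearMap.ker π)
  have hr (w : LinearMap.ker π) : r w = t • w := by
    rw [← hγ, ← hκ]
    simp only [r, LinearMap.comp_apply, ← map_smul, ← map_add]
    congr 2
    simp
  let d : F →ₗ[R] F := t • LinearMap.id - (LinearMap.ker π).subtype ∘ₗ r
  have hd : LinearMap.ker π ≤ LinearMap.ker d := fun w hw ↦ by
    simp [d, hr ⟨w, hw⟩]
  refine mem_freeLocus_of_comp_eq_smul ht
    ((LinearMap.ker π).liftQ d hd ∘ₗ (π.quotKerEquivOfSurjective hπ).symm) π fun m ↦ ?_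
  obtain ⟨f, rfl⟩ := hπ m
  have hf : (π.quotKerEquivOfSurjective hπ).symm (π f) = (LinearMap.ker π).mkQ f := by
    rw [LinearEquiv.symm_apply_eq]; rfl
  simp [hf, d]

end SyzygyPushout
end

section

universe u

variable {R : Type} [CommRing R]

theorem nonfreeLocus_eq_compl (M : ModuleCat R) :
    nonfreeLocus R M = (Module.freeLocus R M)ᶜ := rfl

theorem isClosed_nonfreeLocus [IsNoetherianRing R] (M : ModuleCat R) [Module.Finite R M] :
    IsClosed (nonfreeLocus R M) := by
  have := Module.finitePresentation_of_finite R M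
  rw [nonfreeLocus_eq_compl, isClosed_compl_iff]
  exact Module.isOpen_freeLocus

theorem IsResolving.syzygyPushout_mem {𝒳 : Set (ModuleCat R)} (h𝒳 : IsResolving R 𝒳)
    {M F : ModuleCat R} [Module.Finite R F] [Module.Projective R F] (hM : M ∈ 𝒳)
    {π : F →ₗ[R] M} (hπ : Function.Surjective π) (x : R) :
    ModuleCat.of R (SyzygyPushout π x) ∈ 𝒳 := by
  have hΩ : ModuleCat.of R (LinearMap.ker π) ∈ 𝒳 :=
    h𝒳.ker_epi_closed _ F M ⟨ModuleCat.ofHom (LinearMap.ker π).subtype, ModuleCat.ofHom π,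
      Subtype.val_injective, hπ, π.exact_subtype_ker_map⟩ (h𝒳.proj_mem F ‹_› ‹_›) hM
  exact h𝒳.ext_closed _ _ M ⟨ModuleCat.ofHom (SyzygyPushout.inr π x),
    ModuleCat.ofHom (SyzygyPushout.toBase π x), SyzygyPushout.inr_injective,
    SyzygyPushout.toBase_surjective hπ, SyzygyPushout.exact_inr_toBase⟩ hΩ hM

variable [IsNoetherianRing R]

/-- The nonfree locus of a module can be cut down to lie in `V(x)` within every resolving class
containing the module, keeping all of its points that lie in `V(x)`. -/
theorem exists_nonfreeLocus_subset_inter_zeroLocus (M : ModuleCat.{u} R)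
    [Module.Finite R M] (x : R) :
    ∃ Y : ModuleCat.{u} R, Module.Finite R Y ∧ (∀ 𝒳, IsResolving R 𝒳 → M ∈ 𝒳 → Y ∈ 𝒳) ∧
      nonfreeLocus R Y ⊆ nonfreeLocus R M ∩ PrimeSpectrum.zeroLocus {x} ∧
      ∀ p ∈ nonfreeLocus R M, x ∈ p.asIdeal → p ∈ nonfreeLocus R Y := by
  obtain ⟨n, f, hf⟩ := Module.Finite.exists_fin' R M
  let F : ModuleCat.{u} R := ModuleCat.of R (ULift.{u} (Fin n) → R)
  have : Module.Finite R F := inferInstanceAs (Module.Finite R (ULift.{u} (Fin n) → R))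
  have : Module.Projective R F := inferInstanceAs (Module.Projective R (ULift.{u} (Fin n) → R))
  let π : F →ₗ[R] M := f ∘ₗ (LinearEquiv.funCongrLeft R R Equiv.ulift.symm).toLinearMap
  have hπ : Function.Surjective π := hf.comp (LinearEquiv.surjective _)
  refine ⟨ModuleCat.of R (SyzygyPushout π x), inferInstanceAs (Module.Finite R (SyzygyPushout π x)),
    fun 𝒳 h𝒳 hM ↦ h𝒳.syzygyPushout_mem hM hπ x, fun q hq ↦ ⟨fun hqM ↦ hq ?_, ?_⟩,
    fun p hp hx hpY ↦ hp (SyzygyPushout.mem_freeLocus_base hπ hx hpY)⟩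
  · exact SyzygyPushout.freeLocus_base_subset hπ hqM
  · rw [PrimeSpectrum.mem_zeroLocus, Set.singleton_subset_iff]
    by_contra hx
    exact hq (SyzygyPushout.mem_freeLocus_of_notMem hx)

/-- The closure of each point of the nonfree locus of `X` is the nonfree locus of a module in the
resolving closure of `X`. -/
theorem exists_mem_resClosure_nonfreeLocus_eq_zeroLocus (X : ModuleCat.{u} R) [Module.Finite R X]
    {p : PrimeSpectrum R} (hp : p ∈ nonfreeLocus R X) :
    ∃ Y : ModuleCat.{u} R, Module.Finite R Y ∧ Y ∈ resClosure R {X} ∧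
      nonfreeLocus R Y = PrimeSpectrum.zeroLocus (p.asIdeal : Set R) := by
  suffices h : ∀ s : Finset R, (s : Set R) ⊆ p.asIdeal → ∃ Y : ModuleCat.{u} R,
      Module.Finite R Y ∧ Y ∈ resClosure R {X} ∧ p ∈ nonfreeLocus R Y ∧
      nonfreeLocus R Y ⊆ PrimeSpectrum.zeroLocus (s : Set R) by
    obtain ⟨s, hs⟩ := (IsNoetherian.noetherian p.asIdeal : p.asIdeal.FG)
    obtain ⟨Y, hY, hYX, hpY, hYs⟩ := h s (hs ▸ Submodule.subset_span)
    refine ⟨Y, hY, hYX, subset_antisymm ?_ fun q hq ↦ ?_⟩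
    · rwa [← hs, PrimeSpectrum.zeroLocus_span]
    · exact ((PrimeSpectrum.le_iff_specializes p q).1 hq).mem_closed (isClosed_nonfreeLocus Y) hpY
  classical
  intro s
  induction s using Finset.induction_on with
  | empty =>
    exact fun _ ↦ ⟨X, ‹_›, fun 𝒳 h𝒳 ↦ h𝒳.2 rfl, hp, by simp⟩
  | insert x s _ ih =>
    intro hs
    rw [Finset.coe_insert, Set.insert_subset_iff] at hs
    obtain ⟨Z, hZ, hZX, hpZ, hZs⟩ := ih hs.2
    obtain ⟨Y, hY, hres, hsub, hmem⟩ := exists_nonfreeLocus_subset_inter_zeroLocus Z x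
    refine ⟨Y, hY, fun 𝒳 h𝒳 ↦ hres 𝒳 h𝒳.1 (hZX 𝒳 h𝒳), hmem p hpZ hs.1, fun q hq ↦ ?_⟩
    rw [Finset.coe_insert, Set.insert_eq, PrimeSpectrum.zeroLocus_union]
    exact ⟨(hsub hq).2, hZs (hsub hq).1⟩

end

/-- The nonfree locus of a nonprojective module admits a
decomposition into irreducible closed nonfree loci of modules in its resolving
closure. -/
theorem stmt9 (R : Type) [CommRing R] [IsNoetherianRing R]
    (X : ModuleCat R) (hX : Module.Finite R X) (hXproj : ¬ Module.Projective R X) :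
    ∃ (n : ℕ) (Y : Fin n → ModuleCat R),
      (∀ i, Module.Finite R (Y i) ∧ Y i ∈ resClosure R {X}) ∧
      (nonfreeLocus R X = ⋃ i, nonfreeLocus R (Y i)) ∧
      (∀ i, IsIrreducible (nonfreeLocus R (Y i)) ∧ IsClosed (nonfreeLocus R (Y i))) := by
  obtain ⟨S, hS, hcl, hirr, hU⟩ :=
    TopologicalSpace.NoetherianSpace.exists_finite_set_isClosed_irreducible
      (isClosed_nonfreeLocus X)
  have key (t : S) : ∃ Y : ModuleCat R, Module.Finite R Y ∧ Y ∈ resClosure R {X} ∧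
      nonfreeLocus R Y = t := by
    obtain ⟨p, hp⟩ := QuasiSober.sober (hirr t t.2) (hcl t t.2)
    have hpX : p ∈ nonfreeLocus R X := by
      rw [hU]
      exact ⟨t, t.2, hp.mem⟩
    obtain ⟨Y, hY, hYX, hYp⟩ := exists_mem_resClosure_nonfreeLocus_eq_zeroLocus X hpX
    exact ⟨Y, hY, hYX, by rw [hYp, ← PrimeSpectrum.closure_singleton, hp.def]⟩
  choose Y hY hYX hYt using key
  have := hS.to_subtype
  let e := Finite.equivFin S
  refine ⟨Nat.card S, Y ∘ e.symm, fun i ↦ ⟨hY _, hYX _⟩, ?_, fun i ↦ ?_⟩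
  · simp only [Function.comp_apply, hYt]
    rw [hU, Set.sUnion_eq_iUnion]
    exact (e.symm.surjective.iUnion_comp fun t : S ↦ (t : Set (PrimeSpectrum R))).symm
  · simp only [Function.comp_apply, hYt]
    exact ⟨hirr _ (e.symm i).2, hcl _ (e.symm i).2⟩
end

section
/- Let R be a commutative noetherian ring and W a nonempty Zariski-closed subset of Spec R. Then W = NF(X) for some finitely generated R-module X if and only if for every prime ideal p ∈ W the local ring R_p is not a field. Moreover, when this holds, X can be chosen inside the resolving closure res(⊕_{p ∈ min W} R/p), where min W is the (finite) set of minimal elements of W under inclusion. -/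
open CategoryTheory

/-- Over a field, every module is free. -/
theorem IsField.module_free {K V : Type*} [CommRing K] (hK : IsField K) [AddCommGroup V]
    [Module K V] : Module.Free K V :=
  letI := hK.toField
  Module.Free.of_divisionRing K V

/-- Localization preserves direct summands, so a summand of a module with projective localization
has projective localization. -/
theorem LocalizedModule.projective_of_split {R M N : Type*} [CommRing R] [AddCommGroup M]
    [Module R M] [AddCommGroup N] [Module R N] (S : Submonoid R) (i : N →ₗ[R] M) (s : M →ₗ[R] N)
    (h : s ∘ₗ i = LinearMap.id) [Module.Projective (Localization S) (LocalizedModule S M)] :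
    Module.Projective (Localization S) (LocalizedModule S N) := by
  refine Module.Projective.of_split (LocalizedModule.map S i) (LocalizedModule.map S s) ?_
  ext x
  induction x using LocalizedModule.induction_on with
  | h m t => simpa [LocalizedModule.map_mk] using
      congrArg (LocalizedModule.mk · t) (LinearMap.congr_fun h m)

/-- If the localization of a direct sum is free, the localization of each term is projective. -/
theorem LocalizedModule.projective_of_free_directSum {R ι : Type*} [CommRing R]
    (S : Submonoid R) (M : ι → Type*) [∀ i, AddCommGroup (M i)] [∀ i, Module R (M i)]
    (h : Module.Free (Localization S) (LocalizedModule S (DirectSum ι M))) (i : ι) :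
    Module.Projective (Localization S) (LocalizedModule S (M i)) := by
  classical
  have : Module.Projective (Localization S) (LocalizedModule S (DirectSum ι M)) :=
    Module.Projective.of_free
  exact LocalizedModule.projective_of_split S (DirectSum.lof R ι M i) (DirectSum.component R ι M i)
    (LinearMap.ext fun x ↦ DirectSum.component.lof_self R i x)

/-- Linearly equivalent modules, possibly in different universes, have the same nonfree locus. -/
theorem nonfreeLocus_congr {R : Type} [CommRing R] {M N : ModuleCat R} (e : M ≃ₗ[R] N) :
    nonfreeLocus R M = nonfreeLocus R N := by
  ext p
  exact not_congr (Module.Free.iff_of_equiv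
    (IsLocalizedModule.mapEquiv p.asIdeal.primeCompl
      (LocalizedModule.mkLinearMap p.asIdeal.primeCompl M)
      (LocalizedModule.mkLinearMap p.asIdeal.primeCompl N)
      (Localization.AtPrime p.asIdeal) e))

/-- If `p ≤ q` and `(R ⧸ p)_q` is projective over `R_q`, then `R_p` is a field. -/
theorem isField_of_projective_localizedModule_quotient {R : Type*} [CommRing R]
    (p q : Ideal R) [p.IsPrime] [q.IsPrime] (hpq : p ≤ q)
    [Module.Projective (Localization.AtPrime q) (LocalizedModule q.primeCompl (R ⧸ p))] :
    IsField (Localization.AtPrime p) := by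
  have : Module.Finite (Localization.AtPrime q) (LocalizedModule q.primeCompl (R ⧸ p)) :=
    Module.Finite.of_isLocalizedModule q.primeCompl
      (LocalizedModule.mkLinearMap q.primeCompl (R ⧸ p))
  have : Module.Free (Localization.AtPrime q) (LocalizedModule q.primeCompl (R ⧸ p)) :=
    have : Module.Flat (Localization.AtPrime q) (LocalizedModule q.primeCompl (R ⧸ p)) :=
      Module.Flat.of_projective
    Module.free_of_flat_of_isLocalRing
  have : Nontrivial (LocalizedModule q.primeCompl (R ⧸ p)) := by
    rw [← not_subsingleton_iff_nontrivial, LocalizedModule.subsingleton_iff]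
    intro h
    obtain ⟨r, hr, hr1⟩ := h 1
    rw [Algebra.smul_def, mul_one, Ideal.Quotient.algebraMap_eq,
      Ideal.Quotient.eq_zero_iff_mem] at hr1
    exact hr (hpq hr1)
  rw [IsLocalRing.isField_iff_maximalIdeal_eq, ← Localization.AtPrime.map_eq_maximalIdeal,
    Ideal.map_eq_bot_iff_le_ker]
  intro a ha
  have hq : algebraMap R (Localization.AtPrime q) a = 0 := by
    refine FaithfulSMul.eq_of_smul_eq_smul
      (α := LocalizedModule q.primeCompl (R ⧸ p)) fun x ↦ ?_
    rw [algebraMap_smul, zero_smul]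
    induction x using LocalizedModule.induction_on with
    | h m t =>
      have hm : a • m = 0 := by
        rw [Algebra.smul_def, Ideal.Quotient.algebraMap_eq,
          Ideal.Quotient.eq_zero_iff_mem.mpr ha, zero_mul]
      rw [LocalizedModule.smul'_mk, hm, LocalizedModule.zero_mk]
  obtain ⟨c, hc⟩ := (IsLocalization.map_eq_zero_iff q.primeCompl _ a).mp hq
  exact (IsLocalization.map_eq_zero_iff p.primeCompl _ a).mpr
    ⟨⟨c, fun h ↦ c.2 (hpq h)⟩, hc⟩

/-- A closed subset of the spectrum has the minimal primes of its vanishing ideal as its minimal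
elements. -/
theorem PrimeSpectrum.asIdeal_mem_minimalPrimes_vanishingIdeal_iff {R : Type*} [CommRing R]
    {W : Set (PrimeSpectrum R)} (hW : IsClosed W) (q : PrimeSpectrum R) :
    q.asIdeal ∈ (PrimeSpectrum.vanishingIdeal W).minimalPrimes ↔
      q ∈ W ∧ ∀ r ∈ W, r ≤ q → r = q := by
  have mem_iff (r : PrimeSpectrum R) : PrimeSpectrum.vanishingIdeal W ≤ r.asIdeal ↔ r ∈ W := by
    rw [← SetLike.coe_subset_coe, ← PrimeSpectrum.mem_zeroLocus,
      PrimeSpectrum.zeroLocus_vanishingIdeal_eq_closure, hW.closure_eq]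
  constructor
  · intro h
    exact ⟨(mem_iff q).mp h.1.2, fun r hr hrq ↦
      le_antisymm hrq (h.2 ⟨r.2, (mem_iff r).mpr hr⟩ hrq)⟩
  · rintro ⟨hq, hmin⟩
    exact ⟨⟨q.2, (mem_iff q).mpr hq⟩, fun J hJ hJq ↦
      (hmin ⟨J, hJ.1⟩ ((mem_iff ⟨J, hJ.1⟩).mp hJ.2) hJq).ge⟩

/-- A closed subset of a noetherian spectrum has finitely many minimal elements. -/
theorem PrimeSpectrum.finite_minimal_of_isClosed {R : Type*} [CommRing R] [IsNoetherianRing R]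
    {W : Set (PrimeSpectrum R)} (hW : IsClosed W) :
    {q | q ∈ W ∧ ∀ r ∈ W, r ≤ q → r = q}.Finite := by
  refine Set.Finite.of_finite_image (f := PrimeSpectrum.asIdeal)
    (((PrimeSpectrum.vanishingIdeal W).finite_minimalPrimes_of_isNoetherianRing R).subset ?_)
    fun _ _ _ _ h ↦ PrimeSpectrum.ext h
  rintro _ ⟨q, hq, rfl⟩
  exact (asIdeal_mem_minimalPrimes_vanishingIdeal_iff hW q).mpr hq

/-- Every point of a closed subset of the spectrum lies above a minimal one. -/
theorem PrimeSpectrum.exists_minimal_le_of_isClosed {R : Type*} [CommRing R]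
    {W : Set (PrimeSpectrum R)} (hW : IsClosed W) {q : PrimeSpectrum R} (hq : q ∈ W) :
    ∃ p ∈ {q | q ∈ W ∧ ∀ r ∈ W, r ≤ q → r = q}, p ≤ q := by
  have hle : PrimeSpectrum.vanishingIdeal W ≤ q.asIdeal := fun a ha ↦
    (PrimeSpectrum.mem_vanishingIdeal W a).mp ha q hq
  obtain ⟨p, hp, hpq⟩ := Ideal.exists_minimalPrimes_le hle
  exact ⟨⟨p, hp.1.1⟩, (asIdeal_mem_minimalPrimes_vanishingIdeal_iff hW ⟨p, hp.1.1⟩).mp hp, hpq⟩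

/-- If no local ring at a point of the closed set `W` is a field, then `W` is the nonfree locus of
`⊕_{p ∈ min W} R ⧸ p`. -/
theorem nonfreeLocus_directSum_quotient_minimal (R : Type) [CommRing R]
    {W : Set (PrimeSpectrum R)} (hWc : IsClosed W)
    (hW : ∀ p ∈ W, ¬ IsField (Localization.AtPrime p.asIdeal)) :
    nonfreeLocus R (ModuleCat.of R (DirectSum
      {q | q ∈ W ∧ ∀ r ∈ W, r ≤ q → r = q}
      (fun p => R ⧸ (p : PrimeSpectrum R).asIdeal))) = W := by
  ext q
  constructor
  · intro hq
    by_contra hqW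
    refine hq ?_
    rw [← hWc.closure_eq, ← PrimeSpectrum.zeroLocus_vanishingIdeal_eq_closure,
      PrimeSpectrum.mem_zeroLocus, Set.not_subset] at hqW
    obtain ⟨f, hf, hfq⟩ := hqW
    have : Subsingleton (LocalizedModule q.asIdeal.primeCompl (DirectSum
        {q | q ∈ W ∧ ∀ r ∈ W, r ≤ q → r = q}
        (fun p => R ⧸ (p : PrimeSpectrum R).asIdeal))) := by
      refine LocalizedModule.subsingleton_iff.mpr fun x ↦ ⟨f, hfq, ?_⟩
      ext p
      rw [DirectSum.smul_apply, Algebra.smul_def, Ideal.Quotient.algebraMap_eq,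
        Ideal.Quotient.eq_zero_iff_mem.mpr
          ((PrimeSpectrum.mem_vanishingIdeal W f).mp hf p p.2.1), zero_mul, DirectSum.zero_apply]
    exact Module.Free.of_subsingleton _ _
  · intro hq hfree
    obtain ⟨p, hp, hpq⟩ := PrimeSpectrum.exists_minimal_le_of_isClosed hWc hq
    have : Module.Projective (Localization.AtPrime q.asIdeal)
        (LocalizedModule q.asIdeal.primeCompl (R ⧸ p.asIdeal)) :=
      LocalizedModule.projective_of_free_directSum q.asIdeal.primeCompl
        (fun p : {q | q ∈ W ∧ ∀ r ∈ W, r ≤ q → r = q} => R ⧸ (p : PrimeSpectrum R).asIdeal)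
        hfree ⟨p, hp⟩
    exact hW p hp.1 (isField_of_projective_localizedModule_quotient p.asIdeal q.asIdeal hpq)

/-- A nonempty closed subset `W` of `Spec R` is the nonfree locus
of a finitely generated module iff `R_p` is not a field for every `p ∈ W`; moreover,
such a module can then be found in `res (⊕_{p ∈ min W} R/p)`. -/
theorem stmt10 (R : Type) [CommRing R] [IsNoetherianRing R]
    (W : Set (PrimeSpectrum R)) (hW : W.Nonempty) (hWc : IsClosed W) :
    ((∃ X : ModuleCat R, Module.Finite R X ∧ nonfreeLocus R X = W) ↔
      ∀ p ∈ W, ¬ IsField (Localization.AtPrime p.asIdeal)) ∧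
    ((∀ p ∈ W, ¬ IsField (Localization.AtPrime p.asIdeal)) →
      ∃ X : ModuleCat R, Module.Finite R X ∧
        X ∈ resClosure R {ModuleCat.of R (DirectSum
          {q | q ∈ W ∧ ∀ r ∈ W, r ≤ q → r = q}
          (fun p => R ⧸ (p : PrimeSpectrum R).asIdeal))} ∧
        nonfreeLocus R X = W) := by
  have key (h : ∀ p ∈ W, ¬ IsField (Localization.AtPrime p.asIdeal)) :
      ∃ X : ModuleCat R, Module.Finite R X ∧
        X ∈ resClosure R {ModuleCat.of R (DirectSum
          {q | q ∈ W ∧ ∀ r ∈ W, r ≤ q → r = q}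
          (fun p => R ⧸ (p : PrimeSpectrum R).asIdeal))} ∧
        nonfreeLocus R X = W := by
    have : Finite {q | q ∈ W ∧ ∀ r ∈ W, r ≤ q → r = q} :=
      PrimeSpectrum.finite_minimal_of_isClosed hWc
    exact ⟨_, Module.Finite.instDirectSum (R := R) _, fun 𝒴 h𝒴 ↦ h𝒴.2 rfl,
      nonfreeLocus_directSum_quotient_minimal R hWc h⟩
  refine ⟨⟨?_, fun h ↦ ?_⟩, key⟩
  · rintro ⟨X, -, rfl⟩ p hp hK
    exact hp hK.module_free
  · obtain ⟨X, hfin, -, hX⟩ := key h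
    exact ⟨ModuleCat.of R (ULift X), Module.Finite.ulift,
      (nonfreeLocus_congr ULift.moduleEquiv).trans hX⟩
end
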